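/- arXiv:1411.3659 — 2 statements merged into one kernel-verified Lean document; each statement's English description precedes it below -/
import Mathlib

section
/- (L⁴ Strichartz estimate in adapted V^p spaces, Corollary 5.4 (ii).) For every T > 0 and every 1 ≤ p < 4 there exists a constant C(T, p) > 0 such that for every N ≥ 1, every sign σ ∈ {+1, −1}, and every frequency-localized space-time function u_N at scale N for which the map t ↦ (e^{−iσt⟨n⟩} c_n(t))_{n ∈ S_N} is right-continuous into ℓ²(S_N), tends to 0 as t → −∞, and has finite V^p-norm, one has ‖u_N‖_{L⁴([0,T] × T³)} ≤ C(T, p) N^{1/2} ‖u_N‖_{V^p_σ}. -/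
open MeasureTheory Filter
open scoped ENNReal Classical

section UpVp
variable {B : Type*} [NormedAddCommGroup B] [NormedSpace ℂ B]

/-- Extension of a function on `ℝ` to `EReal`, with value `0` at `∞`
(the convention `v(∞) = 0`). -/
noncomputable def extEReal (v : ℝ → B) : EReal → B :=
  fun x => if x = ⊤ then 0 else if x = ⊥ then 0 else v x.toReal

/-- A `U^p` atom: a step function `a(s) = ∑_{k=1}^{K} 1_{[t_{k-1}, t_k)}(s) φ_{k-1}`
associated with a partition `-∞ < t₀ < t₁ < ⋯ < t_K ≤ ∞` and values
`φ₀, …, φ_{K-1} ∈ B` with `∑_{k} ‖φ_k‖^p = 1`. -/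
noncomputable def IsUpAtom (p : ℝ) (a : ℝ → B) : Prop :=
  ∃ (K : ℕ) (t : Fin (K + 1) → EReal) (φ : Fin K → B),
    StrictMono t ∧ (∀ i, t i ≠ ⊥) ∧ (∑ k, ‖φ k‖ ^ p) = 1 ∧
    ∀ s : ℝ, a s =
      ∑ k : Fin K, if t k.castSucc ≤ (s : EReal) ∧ (s : EReal) < t k.succ then φ k else 0

/-- The `U^p` (atomic space) norm of `u : ℝ → B`: the infimum of `∑_j |λ_j|` over all
representations `u = ∑_j λ_j a_j` (pointwise) with `(λ_j) ∈ ℓ¹(ℂ)` and `U^p` atoms `a_j`;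
it equals `∞` when no such representation exists. -/
noncomputable def UpNorm (p : ℝ) (u : ℝ → B) : ℝ≥0∞ :=
  sInf { M : ℝ≥0∞ | ∃ (lam : ℕ → ℂ) (a : ℕ → ℝ → B),
    (∀ j, IsUpAtom p (a j)) ∧ Summable (fun j => ‖lam j‖) ∧
    (∀ s : ℝ, HasSum (fun j => lam j • a j s) (u s)) ∧
    M = ENNReal.ofReal (∑' j, ‖lam j‖) }

/-- The `V^p` variation norm of `v : ℝ → B`: the supremum over partitions
`-∞ < t₀ < t₁ < ⋯ < t_K ≤ ∞` of `(∑_{i=1}^K ‖v(t_i) - v(t_{i-1})‖^p)^{1/p}`,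
with the convention `v(∞) = 0`. -/
noncomputable def VpNorm (p : ℝ) (v : ℝ → B) : ℝ≥0∞ :=
  ⨆ (K : ℕ) (t : Fin (K + 1) → EReal) (_ : StrictMono t) (_ : ∀ i, t i ≠ ⊥),
    ENNReal.ofReal
      ((∑ i : Fin K, ‖extEReal v (t i.succ) - extEReal v (t i.castSucc)‖ ^ p) ^ (1 / p))

end UpVp

/-- The torus `T³`, realized as the cube `[0, 2π)³` in `ℝ³` (with Lebesgue measure). -/
noncomputable def cube : Set (Fin 3 → ℝ) := Set.univ.pi fun _ => Set.Ico (0:ℝ) (2 * Real.pi)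

/-- The Euclidean norm `|n|` of a lattice point `n ∈ ℤ³`. -/
noncomputable def normZ (n : Fin 3 → ℤ) : ℝ := Real.sqrt (∑ i, ((n i : ℝ)) ^ 2)

/-- The Japanese bracket `⟨n⟩ = (1 + |n|²)^{1/2}` of a lattice point `n ∈ ℤ³`. -/
noncomputable def jbZ (n : Fin 3 → ℤ) : ℝ := Real.sqrt (1 + ∑ i, ((n i : ℝ)) ^ 2)

/-- The Euclidean inner product `n·x` for `n ∈ ℤ³`, `x ∈ ℝ³`. -/
noncomputable def dotZ (n : Fin 3 → ℤ) (x : Fin 3 → ℝ) : ℝ := ∑ i, (n i : ℝ) * x i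

/-- The dyadic annulus `S_N = {n ∈ ℤ³ : N ≤ |n| < 2N}`, as a finite set of lattice points. -/
noncomputable def annulus (N : ℝ) : Finset (Fin 3 → ℤ) :=
  (Finset.Icc (fun _ => -⌈2 * N⌉) fun _ => ⌈2 * N⌉).filter fun n =>
    N ≤ normZ n ∧ normZ n < 2 * N

/-- The space-time function `u(t,x) = ∑_{n ∈ S} c_n(t) e^{i n·x}` with frequencies in the
finite set `S ⊂ ℤ³`. -/
noncomputable def freqLocFun (S : Finset (Fin 3 → ℤ)) (c : (Fin 3 → ℤ) → ℝ → ℂ)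
    (t : ℝ) (x : Fin 3 → ℝ) : ℂ :=
  ∑ n ∈ S, c n t * Complex.exp (Complex.I * ((dotZ n x : ℝ) : ℂ))

/-- The modulated coefficient curve `t ↦ (e^{-iσt⟨n⟩} c_n(t))_{n ∈ S}`, valued in `ℓ²(S)`.
The adapted norm `‖u‖_{U^p_σ}` (resp. `‖u‖_{V^p_σ}`) of the frequency-localized function with
coefficients `c` is `UpNorm p (modCurve S σ c)` (resp. `VpNorm p (modCurve S σ c)`). -/
noncomputable def modCurve (S : Finset (Fin 3 → ℤ)) (σ : ℝ) (c : (Fin 3 → ℤ) → ℝ → ℂ) :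
    ℝ → EuclideanSpace ℂ ↥S :=
  fun t => (WithLp.equiv 2 (↥S → ℂ)).symm
    fun n => Complex.exp (-(Complex.I * ((σ * jbZ (n : Fin 3 → ℤ) * t : ℝ) : ℂ))) *
      c (n : Fin 3 → ℤ) t

local notation "E3" => EuclideanSpace ℝ (Fin 3)

theorem norm_add_norm_sub_le_iff {m y : E3} {b : ℝ} (hb : ‖m‖ < b) :
    ‖y + (1 / 2 : ℝ) • m‖ + ‖m - (y + (1 / 2 : ℝ) • m)‖ ≤ b ↔
      b ^ 2 * ‖y‖ ^ 2 - inner ℝ m y ^ 2 ≤ b ^ 2 * (b ^ 2 - ‖m‖ ^ 2) / 4 := by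
  have hm0 := norm_nonneg m
  have hb0 : 0 < b := lt_of_le_of_lt hm0 hb
  have hX : ‖y + (1 / 2 : ℝ) • m‖ ^ 2 = ‖y‖ ^ 2 + ‖m‖ ^ 2 / 4 + inner ℝ m y := by
    rw [norm_add_sq_real, norm_smul, inner_smul_right, real_inner_comm]
    norm_num; ring
  have hY : ‖m - (y + (1 / 2 : ℝ) • m)‖ ^ 2 = ‖y‖ ^ 2 + ‖m‖ ^ 2 / 4 - inner ℝ m y := by
    have : m - (y + (1 / 2 : ℝ) • m) = (1 / 2 : ℝ) • m - y := by module
    rw [this, norm_sub_sq_real, norm_smul, inner_smul_left]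
    norm_num; ring
  have hX0 := norm_nonneg (y + (1 / 2 : ℝ) • m)
  have hY0 := norm_nonneg (m - (y + (1 / 2 : ℝ) • m))
  have htri : ‖y + (1 / 2 : ℝ) • m‖ ≤ ‖y‖ + ‖m‖ / 2 := by
    refine (norm_add_le _ _).trans_eq ?_
    rw [norm_smul]; norm_num; ring
  have hy0 := norm_nonneg y
  have hcs := abs_real_inner_le_norm m y
  generalize ‖y + (1 / 2 : ℝ) • m‖ = X at *
  generalize ‖m - (y + (1 / 2 : ℝ) • m)‖ = Y at *
  generalize (inner ℝ m y : ℝ) = q at *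
  generalize ‖y‖ = r at *
  generalize ‖m‖ = M at *
  have hfact : 0 < b ^ 2 - M ^ 2 := by nlinarith
  constructor
  · intro h
    have h1 : Y ^ 2 ≤ (b - X) ^ 2 := by gcongr; linarith
    have h2 : 2 * b * X ≤ b ^ 2 + 2 * q := by nlinarith
    have h3 : (2 * b * X) ^ 2 ≤ (b ^ 2 + 2 * q) ^ 2 := by gcongr
    nlinarith
  · intro h
    have hq2 : q ^ 2 ≤ (M * r) ^ 2 := by rw [← sq_abs]; gcongr
    have h1 : r ^ 2 * (b ^ 2 - M ^ 2) ≤ (b / 2) ^ 2 * (b ^ 2 - M ^ 2) := by nlinarith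
    have hr : r ≤ b / 2 := by
      have := le_of_mul_le_mul_right h1 hfact
      exact le_of_sq_le_sq this (by positivity) |> fun h => h
    have hXb : X ≤ b := by linarith
    have hq : -(b ^ 2) ≤ 2 * q := by
      have := neg_le_of_abs_le hcs
      nlinarith [mul_le_mul hb.le hr hy0 hb0.le]
    have h3 : (2 * b * X) ^ 2 ≤ (b ^ 2 + 2 * q) ^ 2 := by nlinarith
    have h2 : 2 * b * X ≤ b ^ 2 + 2 * q := by
      refine le_of_sq_le_sq h3 (by linarith)
    have h4 : Y ^ 2 ≤ (b - X) ^ 2 := by nlinarith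
    have := le_of_sq_le_sq h4 (by linarith)
    linarith

/-- The volume of the solid prolate ellipsoid with foci `0` and `m` and major axis `b`. -/
theorem volume_ellipsoid {m : E3} {b : ℝ} (hb : ‖m‖ < b) :
    volume {x : E3 | ‖x‖ + ‖m - x‖ ≤ b} =
      ENNReal.ofReal (b * (b ^ 2 - ‖m‖ ^ 2) / 8) * volume (Metric.ball (0 : E3) 1) := by
  have hm0 := norm_nonneg m
  have hb0 : 0 < b := lt_of_le_of_lt hm0 hb
  have hfact : 0 < b ^ 2 - ‖m‖ ^ 2 := by nlinarith
  set w := Real.sqrt (b ^ 2 - ‖m‖ ^ 2) with hw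
  have hw0 : 0 < w := Real.sqrt_pos.2 hfact
  have hw2 : w ^ 2 = b ^ 2 - ‖m‖ ^ 2 := Real.sq_sqrt hfact.le
  set k : ℝ := 1 / (b * (b + w)) with hk
  let A : E3 →ₗ[ℝ] E3 := LinearMap.transvection (-(innerₛₗ ℝ m)) (k • m)
  have hA : ∀ y, A y = y - (k * inner ℝ m y) • m := by
    intro y
    simp only [A, LinearMap.transvection.apply, LinearMap.neg_apply, innerₛₗ_apply_apply]
    module
  have hdet : LinearMap.det A = w / b := by
    simp only [A, LinearMap.transvection.det, LinearMap.neg_apply, innerₛₗ_apply_apply,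
      inner_smul_right, real_inner_self_eq_norm_sq]
    rw [hk]; field_simp; nlinarith
  have hnorm : ∀ y, ‖A y‖ ^ 2 = ‖y‖ ^ 2 - inner ℝ m y ^ 2 / b ^ 2 := by
    intro y
    rw [hA, norm_sub_sq_real, norm_smul, inner_smul_right, real_inner_comm, mul_pow,
      Real.norm_eq_abs, sq_abs]
    have : ‖m‖ ^ 2 = b ^ 2 - w ^ 2 := by linarith
    rw [this, hk]; field_simp; ring
  have hset : {x : E3 | ‖x‖ + ‖m - x‖ ≤ b} =
      (fun x => x + -((1 / 2 : ℝ) • m)) ⁻¹' (A ⁻¹' Metric.closedBall 0 (w / 2)) := by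
    ext x
    have hx : x = (x + -((1 / 2 : ℝ) • m)) + (1 / 2 : ℝ) • m := by module
    rw [Set.mem_ofPred_eq, Set.mem_preimage]
    generalize x + -((1 / 2 : ℝ) • m) = y at *
    subst hx
    rw [norm_add_norm_sub_le_iff hb, Set.mem_preimage, mem_closedBall_zero_iff,
      ← sq_le_sq₀ (norm_nonneg _) (by positivity), hnorm, ← hw2]
    constructor
    · intro h
      have : (b ^ 2 * ‖y‖ ^ 2 - inner ℝ m y ^ 2) / b ^ 2 ≤ (b ^ 2 * w ^ 2 / 4) / b ^ 2 := by gcongr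
      have e1 : (b ^ 2 * ‖y‖ ^ 2 - inner ℝ m y ^ 2) / b ^ 2 =
          ‖y‖ ^ 2 - inner ℝ m y ^ 2 / b ^ 2 := by field_simp
      have e2 : (b ^ 2 * w ^ 2 / 4) / b ^ 2 = (w / 2) ^ 2 := by field_simp; norm_num
      rwa [e1, e2] at this
    · intro h
      have : b ^ 2 * (‖y‖ ^ 2 - inner ℝ m y ^ 2 / b ^ 2) ≤ b ^ 2 * (w / 2) ^ 2 := by gcongr
      convert this using 1
      · field_simp
      · ring
  rw [hset, measure_preimage_add_right,
    Measure.addHaar_preimage_linearMap _ (by rw [hdet]; positivity),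
    Measure.addHaar_closedBall _ _ (by positivity), ← mul_assoc,
    ← ENNReal.ofReal_mul (by positivity), hdet, ← hw2, abs_of_pos (by positivity)]
  congr 2
  simp only [finrank_euclideanSpace, Fintype.card_fin]
  field_simp
  norm_num

theorem volume_ellipsoidal_shell_le {m : E3} {a b : ℝ} (hb : ‖m‖ < b) (hab : a ≤ b) :
    volume {x : E3 | a < ‖x‖ + ‖m - x‖ ∧ ‖x‖ + ‖m - x‖ ≤ b} ≤
      ENNReal.ofReal (b ^ 2 * (b - a)) * volume (Metric.ball (0 : E3) 1) := by
  have hm0 := norm_nonneg m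
  have hb0 : 0 < b := lt_of_le_of_lt hm0 hb
  rcases le_or_gt a ‖m‖ with ha | ha
  · refine (measure_mono (t := {x : E3 | ‖x‖ + ‖m - x‖ ≤ b}) fun x hx => hx.2).trans ?_
    rw [volume_ellipsoid hb]
    gcongr
    have : (b - ‖m‖) * (b + ‖m‖) ≤ (b - a) * (2 * b) := by gcongr; linarith
    nlinarith [mul_le_mul_of_nonneg_left this hb0.le,
      mul_nonneg (sq_nonneg b) (sub_nonneg.2 hab)]
  · have hset : {x : E3 | a < ‖x‖ + ‖m - x‖ ∧ ‖x‖ + ‖m - x‖ ≤ b} =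
        {x : E3 | ‖x‖ + ‖m - x‖ ≤ b} \ {x : E3 | ‖x‖ + ‖m - x‖ ≤ a} := by
      ext x; simp [and_comm]
    have hmeas : MeasurableSet {x : E3 | ‖x‖ + ‖m - x‖ ≤ a} :=
      (isClosed_le (by fun_prop) continuous_const).measurableSet
    have hfin : volume (Metric.ball (0 : E3) 1) ≠ ⊤ := measure_ball_lt_top.ne
    have ha0 : 0 < a := hm0.trans_lt ha
    have hsub : {x : E3 | ‖x‖ + ‖m - x‖ ≤ a} ⊆ {x : E3 | ‖x‖ + ‖m - x‖ ≤ b} :=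
      fun x hx => le_trans hx hab
    rw [hset, measure_sdiff hsub hmeas.nullMeasurableSet
      (by rw [volume_ellipsoid ha]; exact ENNReal.mul_ne_top ENNReal.ofReal_ne_top hfin),
      volume_ellipsoid hb, volume_ellipsoid ha, ← ENNReal.sub_mul (fun _ _ => hfin),
      ← ENNReal.ofReal_sub _ (by have : 0 ≤ a ^ 2 - ‖m‖ ^ 2 := by nlinarith
                                 positivity)]
    gcongr
    have h1 : a * b ≤ b * b := by gcongr
    have h2 : a * a ≤ b * b := by gcongr
    nlinarith [mul_le_mul_of_nonneg_left (add_le_add h1 h2) (sub_nonneg.2 hab),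
      mul_nonneg (sq_nonneg ‖m‖) (sub_nonneg.2 hab), mul_nonneg (sq_nonneg b) (sub_nonneg.2 hab)]

/-- A lattice point viewed as a vector of Euclidean space. -/
noncomputable def latticeVec (n : Fin 3 → ℤ) : E3 := WithLp.toLp 2 fun i => (n i : ℝ)

theorem norm_latticeVec (n : Fin 3 → ℤ) : ‖latticeVec n‖ = normZ n := by
  simp [latticeVec, EuclideanSpace.norm_eq, normZ]

theorem latticeVec_sub (m n : Fin 3 → ℤ) : latticeVec (m - n) = latticeVec m - latticeVec n := by
  ext i; simp [latticeVec]

theorem normZ_le_jbZ (n : Fin 3 → ℤ) : normZ n ≤ jbZ n :=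
  Real.sqrt_le_sqrt (by linarith)

theorem jbZ_le_normZ_add_one (n : Fin 3 → ℤ) : jbZ n ≤ normZ n + 1 := by
  have h : 0 ≤ ∑ i, (n i : ℝ) ^ 2 := Finset.sum_nonneg fun i _ => sq_nonneg _
  refine Real.sqrt_le_iff.2 ⟨by unfold normZ; positivity, ?_⟩
  have h0 : 0 ≤ normZ n := Real.sqrt_nonneg _
  have : normZ n ^ 2 = ∑ i, (n i : ℝ) ^ 2 := Real.sq_sqrt h
  nlinarith

/-- The unit cube of `ℝ³` with lower corner `n`. -/
def unitCube (n : Fin 3 → ℤ) : Set E3 := {x | ∀ i, (n i : ℝ) ≤ x i ∧ x i < n i + 1}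

theorem unitCube_eq_preimage (n : Fin 3 → ℤ) :
    unitCube n = WithLp.ofLp ⁻¹' (Set.univ.pi fun i => Set.Ico (n i : ℝ) (n i + 1)) := by
  ext x; simp [unitCube]

theorem measurableSet_unitCube (n : Fin 3 → ℤ) : MeasurableSet (unitCube n) := by
  rw [unitCube_eq_preimage]
  exact (PiLp.volume_preserving_ofLp (Fin 3)).measurable
    (MeasurableSet.univ_pi fun i => measurableSet_Ico)

theorem volume_unitCube (n : Fin 3 → ℤ) : volume (unitCube n) = 1 := by
  rw [unitCube_eq_preimage, (PiLp.volume_preserving_ofLp (Fin 3)).measure_preimage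
    (MeasurableSet.univ_pi fun i => measurableSet_Ico).nullMeasurableSet, Real.volume_pi_Ico]
  simp

theorem pairwise_disjoint_unitCube : Pairwise (Function.onFun Disjoint unitCube) := by
  intro n n' h
  refine Set.disjoint_left.2 fun x hx hx' => h (funext fun i => ?_)
  rw [← Int.floor_eq_iff.2 (hx i), ← Int.floor_eq_iff.2 (hx' i)]

theorem norm_sub_latticeVec_le {n : Fin 3 → ℤ} {x : E3} (hx : x ∈ unitCube n) :
    ‖x - latticeVec n‖ ≤ 2 := by
  rw [EuclideanSpace.norm_eq]
  refine Real.sqrt_le_iff.2 ⟨by norm_num, ?_⟩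
  have : ∀ i, ‖(x - latticeVec n) i‖ ^ 2 ≤ 1 := by
    intro i
    have := hx i
    simp only [latticeVec, PiLp.sub_apply, Real.norm_eq_abs, sq_abs]
    nlinarith
  refine (Finset.sum_le_sum fun i _ => this i).trans ?_
  norm_num

/-- The volume of the unit ball of `ℝ³`. -/
noncomputable def ballVol : ℝ := (volume (Metric.ball (0 : E3) 1)).toReal

theorem card_ellipsoidal_shell_le {F : Finset (Fin 3 → ℤ)} {m : Fin 3 → ℤ} {a R : ℝ}
    (h : ∀ n ∈ F, a ≤ jbZ n + jbZ (m - n) ∧ jbZ n + jbZ (m - n) ≤ a + 1)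
    (hR : ∀ n ∈ F, jbZ n + jbZ (m - n) ≤ R) (hR1 : 1 ≤ R) :
    (F.card : ℝ) ≤ 637 * ballVol * R ^ 2 := by
  have hK : 0 ≤ ballVol := ENNReal.toReal_nonneg
  rcases F.eq_empty_or_nonempty with rfl | ⟨n₀, hn₀⟩
  · simp; positivity
  have haR : a ≤ R := (h n₀ hn₀).1.trans (hR n₀ hn₀)
  have hphi : ∀ n, ‖latticeVec n‖ + ‖latticeVec m - latticeVec n‖ = normZ n + normZ (m - n) := by
    intro n
    rw [← latticeVec_sub, norm_latticeVec, norm_latticeVec]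
  have hm : ‖latticeVec m‖ < a + 6 := by
    have h1 := norm_add_le (latticeVec n₀) (latticeVec m - latticeVec n₀)
    rw [add_sub_cancel, hphi] at h1
    linarith [normZ_le_jbZ n₀, normZ_le_jbZ (m - n₀), (h n₀ hn₀).2]
  have hsub : (⋃ n ∈ F, unitCube n) ⊆ {x : E3 | a - 7 < ‖x‖ + ‖latticeVec m - x‖ ∧
      ‖x‖ + ‖latticeVec m - x‖ ≤ a + 6} := by
    refine Set.iUnion₂_subset fun n hn x hx => ?_
    have hd := norm_sub_latticeVec_le hx
    have h1 := (abs_le.1 ((abs_norm_sub_norm_le x (latticeVec n)).trans hd))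
    have h2 : ‖(latticeVec m - x) - (latticeVec m - latticeVec n)‖ ≤ 2 := by
      rwa [sub_sub_sub_cancel_left, norm_sub_rev]
    have h3 := (abs_le.1 ((abs_norm_sub_norm_le _ _).trans h2))
    have h4 := hphi n
    have := h n hn
    have := normZ_le_jbZ n
    have := normZ_le_jbZ (m - n)
    have := jbZ_le_normZ_add_one n
    have := jbZ_le_normZ_add_one (m - n)
    constructor <;> linarith
  have hvol := (measure_mono hsub).trans (volume_ellipsoidal_shell_le hm (by linarith))
  rw [measure_biUnion_finset (fun _ _ _ _ hne => pairwise_disjoint_unitCube hne)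
    (fun n _ => measurableSet_unitCube n)] at hvol
  simp only [volume_unitCube, Finset.sum_const, nsmul_eq_mul, mul_one] at hvol
  have hreal := ENNReal.toReal_mono (ENNReal.mul_ne_top ENNReal.ofReal_ne_top
    measure_ball_lt_top.ne) hvol
  rw [ENNReal.toReal_natCast, ENNReal.toReal_mul, ENNReal.toReal_ofReal
    (by nlinarith [sq_nonneg (a + 6)])] at hreal
  refine hreal.trans ?_
  change _ * ballVol ≤ _
  have : (a + 6) ^ 2 ≤ (7 * R) ^ 2 := by
    have : 0 ≤ a + 6 := (norm_nonneg _).trans hm.le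
    gcongr; linarith
  nlinarith [mul_le_mul_of_nonneg_right this hK, mul_nonneg (sq_nonneg (7 * R)) hK]

theorem summable_inv_one_add_int_sq : Summable fun j : ℤ => (1 + (j : ℝ) ^ 2)⁻¹ := by
  refine Summable.of_norm_bounded_eventually (g := fun j : ℤ => 1 / (j : ℝ) ^ 2)
    (Real.summable_one_div_int_pow.2 (by norm_num)) ?_
  rw [Filter.eventually_cofinite]
  refine (Set.finite_singleton (0 : ℤ)).subset fun j hj => ?_
  by_contra h0
  have h0' : (j : ℝ) ≠ 0 := by simpa using h0
  refine hj ?_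
  rw [Real.norm_of_nonneg (by positivity), one_div]
  have : 0 < (j : ℝ) ^ 2 := by positivity
  gcongr
  linarith

theorem sum_inv_one_add_sq_le {α : Type*} {F : Finset α} {φ : α → ℝ} {B : ℝ}
    (hB : ∀ a : ℝ, ((F.filter fun n => a ≤ φ n ∧ φ n ≤ a + 1).card : ℝ) ≤ B) (τ : ℝ) :
    ∑ n ∈ F, (1 + (φ n - τ) ^ 2)⁻¹ ≤ 3 * (∑' j : ℤ, (1 + (j : ℝ) ^ 2)⁻¹) * B := by
  have hB0 : 0 ≤ B := le_trans (Nat.cast_nonneg _) (hB 0)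
  rw [← Finset.sum_fiberwise_of_maps_to (t := F.image fun n => ⌊φ n - τ⌋)
    (g := fun n => ⌊φ n - τ⌋) fun n hn => Finset.mem_image_of_mem _ hn]
  have hfib : ∀ j : ℤ, ∑ n ∈ F with ⌊φ n - τ⌋ = j, (1 + (φ n - τ) ^ 2)⁻¹ ≤
      3 * (1 + (j : ℝ) ^ 2)⁻¹ * B := by
    intro j
    have hterm : ∀ n ∈ F.filter fun n => ⌊φ n - τ⌋ = j,
        (1 + (φ n - τ) ^ 2)⁻¹ ≤ 3 * (1 + (j : ℝ) ^ 2)⁻¹ := by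
      intro n hn
      obtain ⟨h1, h2⟩ := Int.floor_eq_iff.1 (Finset.mem_filter.1 hn).2
      rw [← div_eq_mul_inv, inv_eq_one_div, div_le_div_iff₀ (by positivity) (by positivity)]
      generalize φ n - τ = y at *
      generalize (j : ℝ) = z at *
      nlinarith [sq_nonneg (2 * y - z), sq_nonneg (y - z)]
    refine (Finset.sum_le_card_nsmul _ _ _ hterm).trans ?_
    rw [nsmul_eq_mul, mul_comm]
    refine mul_le_mul_of_nonneg_left (le_trans ?_ (hB (τ + j))) (by positivity)
    refine Nat.cast_le.2 (Finset.card_le_card fun n hn => ?_)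
    rw [Finset.mem_filter] at hn ⊢
    obtain ⟨h1, h2⟩ := Int.floor_eq_iff.1 hn.2
    exact ⟨hn.1, by linarith, by linarith⟩
  refine (Finset.sum_le_sum fun j _ => hfib j).trans ?_
  rw [← Finset.sum_mul, ← Finset.mul_sum]
  gcongr
  exact summable_inv_one_add_int_sq.sum_le_tsum _ fun j _ => by positivity

theorem integrable_exp_neg_abs : Integrable fun t : ℝ => Real.exp (-|t|) := by
  rw [← integrableOn_univ, ← Set.Iic_union_Ioi (a := (0 : ℝ)), integrableOn_union]
  constructor
  · refine (integrableOn_exp_Iic 0).congr_fun (fun t ht => ?_) measurableSet_Iic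
    rw [abs_of_nonpos ht, neg_neg]
  · refine (integrableOn_exp_neg_Ioi 0).congr_fun (fun t ht => ?_) measurableSet_Ioi
    simp only [abs_of_pos (Set.mem_Ioi.1 ht)]

theorem integrable_exp_neg_abs_mul_exp (ξ : ℝ) : Integrable fun t : ℝ =>
    (Real.exp (-|t|) : ℂ) * Complex.exp (Complex.I * (ξ * t : ℝ)) := by
  refine integrable_exp_neg_abs.mono' (by fun_prop) (Eventually.of_forall fun t => ?_)
  rw [norm_mul, mul_comm Complex.I, Complex.norm_exp_ofReal_mul_I, mul_one,
    Complex.norm_of_nonneg (Real.exp_pos _).le]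

theorem integral_exp_neg_abs_mul_exp (ξ : ℝ) :
    ∫ t : ℝ, (Real.exp (-|t|) : ℂ) * Complex.exp (Complex.I * (ξ * t : ℝ)) = 
      ((2 * (1 + ξ ^ 2)⁻¹ : ℝ) : ℂ) := by
  have hint := integrable_exp_neg_abs_mul_exp ξ
  rw [← intervalIntegral.integral_Iic_add_Ioi hint.integrableOn hint.integrableOn (b := 0)]
  have h1 : ∫ t : ℝ in Set.Iic 0, (Real.exp (-|t|) : ℂ) * Complex.exp (Complex.I * (ξ * t : ℝ)) =
      1 / (1 + Complex.I * ξ) := by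
    rw [setIntegral_congr_fun (g := fun t : ℝ => Complex.exp ((1 + Complex.I * ξ) * t))
      measurableSet_Iic]
    · rw [integral_exp_mul_complex_Iic (by simp)]; simp
    · intro t ht
      simp only
      rw [abs_of_nonpos ht, Complex.ofReal_exp, ← Complex.exp_add]
      push_cast; ring_nf
  have h2 : ∫ t : ℝ in Set.Ioi 0, (Real.exp (-|t|) : ℂ) * Complex.exp (Complex.I * (ξ * t : ℝ)) =
      1 / (1 - Complex.I * ξ) := by
    rw [setIntegral_congr_fun (g := fun t : ℝ => Complex.exp ((-1 + Complex.I * ξ) * t))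
      measurableSet_Ioi]
    · rw [integral_exp_mul_complex_Ioi (by simp)]
      simp only [Complex.ofReal_zero, mul_zero, Complex.exp_zero]
      rw [neg_div, ← div_neg]; ring_nf
    · intro t ht
      simp only
      rw [abs_of_pos ht, Complex.ofReal_exp, ← Complex.exp_add]
      push_cast; ring_nf
  rw [h1, h2]
  have hne : (1 + (ξ : ℂ) ^ 2) ≠ 0 := by
    norm_cast; positivity
  have e : (1 + Complex.I * ξ) * (1 - Complex.I * ξ) = 1 + (ξ : ℂ) ^ 2 := by
    ring_nf; simp
  have hn1 : (1 + Complex.I * ξ) ≠ 0 := fun h => hne (by rw [← e, h, zero_mul])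
  have hn2 : (1 - Complex.I * ξ) ≠ 0 := fun h => hne (by rw [← e, h, mul_zero])
  rw [div_add_div _ _ hn1 hn2, e]
  push_cast
  field_simp; ring

theorem ofReal_norm_sum_sq {α : Type*} (F : Finset α) (z : α → ℂ) :
    ((‖∑ n ∈ F, z n‖ ^ 2 : ℝ) : ℂ) = ∑ n ∈ F, ∑ n' ∈ F, z n * starRingEnd ℂ (z n') := by
  push_cast
  rw [← Complex.mul_conj', map_sum, Finset.sum_mul_sum]

theorem integral_exp_neg_abs_mul_norm_sq_le {α : Type*} {F : Finset α} {A : α → ℂ} {φ : α → ℝ}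
    {G : ℝ} (hG : ∀ n ∈ F, ∑ n' ∈ F, (1 + (φ n' - φ n) ^ 2)⁻¹ ≤ G) :
    ∫ t : ℝ, Real.exp (-|t|) *
        ‖∑ n ∈ F, A n * Complex.exp (Complex.I * (φ n * t : ℝ))‖ ^ 2 ≤
      2 * G * ∑ n ∈ F, ‖A n‖ ^ 2 := by
  have hexp : ∀ t : ℝ, ((Real.exp (-|t|) *
        ‖∑ n ∈ F, A n * Complex.exp (Complex.I * (φ n * t : ℝ))‖ ^ 2 : ℝ) : ℂ) =
      ∑ n ∈ F, ∑ n' ∈ F, (A n * starRingEnd ℂ (A n')) * ((Real.exp (-|t|) : ℂ) *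
        Complex.exp (Complex.I * ((φ n - φ n') * t : ℝ))) := by
    intro t
    rw [Complex.ofReal_mul, ofReal_norm_sum_sq, Finset.mul_sum]
    refine Finset.sum_congr rfl fun n _ => ?_
    rw [Finset.mul_sum]
    refine Finset.sum_congr rfl fun n' _ => ?_
    have : ((φ n - φ n') * t : ℝ) = φ n * t - φ n' * t := by ring
    rw [this, map_mul, ← Complex.exp_conj, Complex.ofReal_sub, mul_sub, sub_eq_add_neg,
      Complex.exp_add, map_mul, Complex.conj_I, Complex.conj_ofReal]
    ring_nf
  have hval : ((∫ t : ℝ, Real.exp (-|t|) *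
        ‖∑ n ∈ F, A n * Complex.exp (Complex.I * (φ n * t : ℝ))‖ ^ 2 : ℝ) : ℂ) =
      ∑ n ∈ F, ∑ n' ∈ F, (A n * starRingEnd ℂ (A n')) *
        ((2 * (1 + (φ n - φ n') ^ 2)⁻¹ : ℝ) : ℂ) := by
    rw [← integral_complex_ofReal]
    simp_rw [hexp]
    have hi : ∀ n n', Integrable fun t : ℝ => (A n * starRingEnd ℂ (A n')) *
        ((Real.exp (-|t|) : ℂ) * Complex.exp (Complex.I * ((φ n - φ n') * t : ℝ))) :=
      fun n n' => (integrable_exp_neg_abs_mul_exp (φ n - φ n')).const_mul _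
    rw [integral_finsetSum _ fun n _ => integrable_finsetSum _ fun n' _ => hi n n']
    refine Finset.sum_congr rfl fun n _ => ?_
    rw [integral_finsetSum _ fun n' _ => hi n n']
    refine Finset.sum_congr rfl fun n' _ => ?_
    rw [integral_const_mul, integral_exp_neg_abs_mul_exp]
  refine (le_abs_self _).trans ?_
  rw [← Real.norm_eq_abs, ← Complex.norm_real, hval]
  have hterm : ∀ n n', ‖(A n * starRingEnd ℂ (A n')) *
      ((2 * (1 + (φ n - φ n') ^ 2)⁻¹ : ℝ) : ℂ)‖ ≤
      ‖A n‖ ^ 2 * (1 + (φ n' - φ n) ^ 2)⁻¹ + ‖A n'‖ ^ 2 * (1 + (φ n - φ n') ^ 2)⁻¹ := by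
    intro n n'
    rw [norm_mul, norm_mul, RCLike.norm_conj, Complex.norm_of_nonneg (by positivity),
      ← neg_sub (φ n), neg_sq]
    have : 0 ≤ (1 + (φ n - φ n') ^ 2)⁻¹ := by positivity
    nlinarith [mul_nonneg (sq_nonneg (‖A n‖ - ‖A n'‖)) this]
  have hS : ∑ n ∈ F, ∑ n' ∈ F, ‖A n‖ ^ 2 * (1 + (φ n' - φ n) ^ 2)⁻¹ ≤ G * ∑ n ∈ F, ‖A n‖ ^ 2 := by
    rw [Finset.mul_sum]
    refine Finset.sum_le_sum fun n hn => ?_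
    rw [← Finset.mul_sum, mul_comm G]
    exact mul_le_mul_of_nonneg_left (hG n hn) (sq_nonneg _)
  calc _ ≤ ∑ n ∈ F, ∑ n' ∈ F, (‖A n‖ ^ 2 * (1 + (φ n' - φ n) ^ 2)⁻¹ +
        ‖A n'‖ ^ 2 * (1 + (φ n - φ n') ^ 2)⁻¹) :=
        (norm_sum_le _ _).trans (Finset.sum_le_sum fun n _ =>
          (norm_sum_le _ _).trans (Finset.sum_le_sum fun n' _ => hterm n n'))
    _ = ∑ n ∈ F, ∑ n' ∈ F, ‖A n‖ ^ 2 * (1 + (φ n' - φ n) ^ 2)⁻¹ +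
        ∑ n ∈ F, ∑ n' ∈ F, ‖A n‖ ^ 2 * (1 + (φ n' - φ n) ^ 2)⁻¹ := by
        simp_rw [Finset.sum_add_distrib]
        congr 1
        exact Finset.sum_comm
    _ ≤ _ := by linarith

theorem dotZ_add (n n' : Fin 3 → ℤ) (x : Fin 3 → ℝ) : dotZ (n + n') x = dotZ n x + dotZ n' x := by
  simp [dotZ, add_mul, Finset.sum_add_distrib]

theorem dotZ_sub (n n' : Fin 3 → ℤ) (x : Fin 3 → ℝ) : dotZ (n - n') x = dotZ n x - dotZ n' x := by
  simp [dotZ, sub_mul, Finset.sum_sub_distrib]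

theorem continuous_dotZ (n : Fin 3 → ℤ) : Continuous (dotZ n) := by
  unfold dotZ; fun_prop

theorem integral_Ico_exp_int_mul (k : ℤ) :
    ∫ x in Set.Ico (0 : ℝ) (2 * Real.pi), Complex.exp (Complex.I * ((k * x : ℝ) : ℂ)) =
      if k = 0 then (2 * Real.pi : ℂ) else 0 := by
  rw [integral_Ico_eq_integral_Ioc, ← intervalIntegral.integral_of_le (by positivity)]
  split_ifs with hk
  · simp [hk]
  · have hne : Complex.I * (k : ℂ) ≠ 0 := by simp [hk]
    have : ∀ x : ℝ, Complex.I * ((k * x : ℝ) : ℂ) = Complex.I * k * x := by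
      intro x; push_cast; ring
    simp_rw [this]
    rw [integral_exp_mul_complex hne]
    have h2 : Complex.I * k * ((2 * Real.pi : ℝ) : ℂ) = k * (2 * Real.pi * Complex.I) := by
      push_cast; ring
    rw [h2, Complex.exp_int_mul_two_pi_mul_I]
    simp

theorem restrict_cube : (volume : Measure (Fin 3 → ℝ)).restrict cube =
    Measure.pi fun _ => volume.restrict (Set.Ico (0 : ℝ) (2 * Real.pi)) := by
  rw [cube, volume_pi, Measure.restrict_pi_pi]

instance isFiniteMeasure_restrict_cube :
    IsFiniteMeasure ((volume : Measure (Fin 3 → ℝ)).restrict cube) := by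
  rw [restrict_cube]; infer_instance

theorem integral_cube_exp_dotZ (n : Fin 3 → ℤ) :
    ∫ x in cube, Complex.exp (Complex.I * (dotZ n x : ℝ)) =
      if n = 0 then ((2 * Real.pi) ^ 3 : ℂ) else 0 := by
  have : ∀ x : Fin 3 → ℝ, Complex.exp (Complex.I * (dotZ n x : ℝ)) =
      ∏ i, Complex.exp (Complex.I * ((n i * x i : ℝ) : ℂ)) := by
    intro x
    rw [← Complex.exp_sum, ← Finset.mul_sum, dotZ]
    push_cast; rfl
  simp_rw [this]
  rw [restrict_cube, integral_fintype_prod_eq_prod (𝕜 := ℂ)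
    (f := fun i (y : ℝ) => Complex.exp (Complex.I * ((n i * y : ℝ) : ℂ)))]
  simp_rw [integral_Ico_exp_int_mul]
  split_ifs with h
  · simp [h]
  · obtain ⟨i, hi⟩ := Function.ne_iff.1 h
    exact Finset.prod_eq_zero (Finset.mem_univ i) (if_neg hi)

theorem integral_cube_norm_sq (M : Finset (Fin 3 → ℤ)) (b : (Fin 3 → ℤ) → ℂ) :
    ∫ x in cube, ‖∑ m ∈ M, b m * Complex.exp (Complex.I * (dotZ m x : ℝ))‖ ^ 2 =
      (2 * Real.pi) ^ 3 * ∑ m ∈ M, ‖b m‖ ^ 2 := by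
  rw [← Complex.ofReal_inj, ← integral_complex_ofReal]
  have hexp : ∀ x : Fin 3 → ℝ,
      ((‖∑ m ∈ M, b m * Complex.exp (Complex.I * (dotZ m x : ℝ))‖ ^ 2 : ℝ) : ℂ) =
      ∑ m ∈ M, ∑ m' ∈ M, (b m * starRingEnd ℂ (b m')) *
        Complex.exp (Complex.I * (dotZ (m - m') x : ℝ)) := by
    intro x
    rw [ofReal_norm_sum_sq]
    refine Finset.sum_congr rfl fun n _ => Finset.sum_congr rfl fun n' _ => ?_
    rw [dotZ_sub, map_mul, ← Complex.exp_conj, Complex.ofReal_sub, mul_sub, sub_eq_add_neg,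
      Complex.exp_add, map_mul, Complex.conj_I, Complex.conj_ofReal]
    ring_nf
  simp_rw [hexp]
  have hi : ∀ m m', Integrable (fun x : Fin 3 → ℝ => (b m * starRingEnd ℂ (b m')) *
      Complex.exp (Complex.I * (dotZ (m - m') x : ℝ))) (volume.restrict cube) := by
    intro m m'
    have := continuous_dotZ (m - m')
    refine (Integrable.of_bound (C := 1) (by fun_prop)
      (Eventually.of_forall fun x => ?_)).const_mul _
    rw [mul_comm, Complex.norm_exp_ofReal_mul_I]
  rw [integral_finsetSum _ fun n _ => integrable_finsetSum _ fun n' _ => hi n n']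
  push_cast
  rw [Finset.mul_sum]
  refine Finset.sum_congr rfl fun m hm => ?_
  rw [integral_finsetSum _ fun n' _ => hi m n']
  simp_rw [integral_const_mul, integral_cube_exp_dotZ, sub_eq_zero]
  rw [Finset.sum_eq_single_of_mem m hm fun m' _ hne => by rw [if_neg hne.symm, mul_zero],
    if_pos rfl, Complex.mul_conj', mul_comm]

theorem sum_sum_eq_sum_sub {β : Type*} [AddCommMonoid β] (S : Finset (Fin 3 → ℤ))
    (h : (Fin 3 → ℤ) → (Fin 3 → ℤ) → β) :
    ∑ n ∈ S, ∑ n' ∈ S, h n n' =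
      ∑ m ∈ Finset.image₂ (· + ·) S S, ∑ n ∈ S with m - n ∈ S, h n (m - n) := by
  rw [Finset.sum_comm' (s := Finset.image₂ (· + ·) S S) (t := fun m => S.filter fun n => m - n ∈ S)
    (t' := S)
    (s' := fun n => (Finset.image₂ (· + ·) S S).filter fun m => m - n ∈ S)
    (by intro m n; simp only [Finset.mem_filter]; tauto)]
  refine Finset.sum_congr rfl fun n hn => ?_
  refine Finset.sum_nbij' (fun n' => n + n') (fun m => m - n) ?_ ?_ ?_ ?_ ?_
  · intro n' hn'
    exact Finset.mem_filter.2 ⟨Finset.mem_image₂_of_mem hn hn', by simpa using hn'⟩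
  · intro m hm
    exact (Finset.mem_filter.1 hm).2
  · intro n' _; simp
  · intro m _; simp
  · intro n' _; simp

theorem integral_cube_norm_pow_four (S : Finset (Fin 3 → ℤ)) (b : (Fin 3 → ℤ) → ℂ) :
    ∫ x in cube, ‖∑ n ∈ S, b n * Complex.exp (Complex.I * (dotZ n x : ℝ))‖ ^ 4 =
      (2 * Real.pi) ^ 3 * ∑ m ∈ Finset.image₂ (· + ·) S S,
        ‖∑ n ∈ S with m - n ∈ S, b n * b (m - n)‖ ^ 2 := by
  rw [← integral_cube_norm_sq]
  refine integral_congr_ae (Eventually.of_forall fun x => ?_)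
  simp only
  rw [show 4 = 2 * 2 from rfl, pow_mul, ← norm_pow, sq (Finset.sum _ _), Finset.sum_mul_sum,
    sum_sum_eq_sum_sub]
  congr 2
  refine Finset.sum_congr rfl fun m _ => ?_
  rw [Finset.sum_mul]
  refine Finset.sum_congr rfl fun n _ => ?_
  have : dotZ m x = dotZ n x + dotZ (m - n) x := by rw [← dotZ_add, add_sub_cancel]
  rw [this, Complex.ofReal_add, mul_add, Complex.exp_add]
  ring

/-- The constant in the bound `const * N ^ 2` for the weighted number of solutions of the
resonance relation at scale `N`. -/
noncomputable def resonanceConst : ℝ := 3 * (∑' j : ℤ, (1 + (j : ℝ) ^ 2)⁻¹) * (637 * ballVol * 36)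

theorem resonanceConst_nonneg : 0 ≤ resonanceConst := by
  have : 0 ≤ ∑' j : ℤ, (1 + (j : ℝ) ^ 2)⁻¹ := tsum_nonneg fun j => by positivity
  have : 0 ≤ ballVol := ENNReal.toReal_nonneg
  unfold resonanceConst; positivity

theorem jbZ_le_of_mem_annulus {N : ℝ} (hN : 1 ≤ N) {n : Fin 3 → ℤ} (hn : n ∈ annulus N) :
    jbZ n ≤ 3 * N := by
  have := (Finset.mem_filter.1 hn).2.2
  linarith [jbZ_le_normZ_add_one n]

theorem sum_resonance_le {N : ℝ} (hN : 1 ≤ N) {σ : ℝ} (hσ : σ ^ 2 = 1) (m n : Fin 3 → ℤ) :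
    ∑ n' ∈ annulus N with m - n' ∈ annulus N,
      (1 + (σ * (jbZ n' + jbZ (m - n')) - σ * (jbZ n + jbZ (m - n))) ^ 2)⁻¹ ≤
      resonanceConst * N ^ 2 := by
  simp_rw [← mul_sub, mul_pow, hσ, one_mul]
  refine (sum_inv_one_add_sq_le (φ := fun n' => jbZ n' + jbZ (m - n'))
    (B := 637 * ballVol * (6 * N) ^ 2) (fun a => ?_) _).trans_eq (by unfold resonanceConst; ring)
  refine card_ellipsoidal_shell_le (m := m) (a := a) (fun n hn => (Finset.mem_filter.1 hn).2)
    (fun n hn => ?_) (by linarith)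
  obtain ⟨h1, h2⟩ := Finset.mem_filter.1 (Finset.mem_filter.1 hn).1
  linarith [jbZ_le_of_mem_annulus hN h1, jbZ_le_of_mem_annulus hN h2]

/-- The free Klein-Gordon evolution, with coefficients `a` at time `0`. -/
noncomputable def freeCoeff (σ : ℝ) (a : (Fin 3 → ℤ) → ℂ) (n : Fin 3 → ℤ) (t : ℝ) : ℂ :=
  Complex.exp (Complex.I * ((σ * jbZ n * t : ℝ) : ℂ)) * a n

theorem continuous_freqLocFun_freeCoeff (S : Finset (Fin 3 → ℤ)) (σ : ℝ) (a : (Fin 3 → ℤ) → ℂ) :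
    Continuous fun q : ℝ × (Fin 3 → ℝ) => freqLocFun S (freeCoeff σ a) q.1 q.2 := by
  unfold freqLocFun freeCoeff
  refine continuous_finsetSum _ fun n _ => ?_
  have := (continuous_dotZ n).comp (continuous_snd (X := ℝ) (Y := Fin 3 → ℝ))
  simp only [Function.comp_def] at this
  fun_prop

theorem freeCoeff_mul_freeCoeff (σ : ℝ) (a : (Fin 3 → ℤ) → ℂ) (m n : Fin 3 → ℤ) (t : ℝ) :
    freeCoeff σ a n t * freeCoeff σ a (m - n) t =
      (a n * a (m - n)) * Complex.exp (Complex.I * ((σ * (jbZ n + jbZ (m - n)) * t : ℝ) : ℂ)) := by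
  have : (σ * (jbZ n + jbZ (m - n)) * t : ℝ) = σ * jbZ n * t + σ * jbZ (m - n) * t := by ring
  rw [this, Complex.ofReal_add, mul_add, Complex.exp_add, freeCoeff, freeCoeff]
  ring

theorem integrable_exp_neg_abs_mul_norm_sq {α : Type*} (F : Finset α) (A : α → ℂ) (φ : α → ℝ) :
    Integrable fun t : ℝ => Real.exp (-|t|) *
      ‖∑ n ∈ F, A n * Complex.exp (Complex.I * (φ n * t : ℝ))‖ ^ 2 := by
  refine (integrable_exp_neg_abs.mul_const ((∑ n ∈ F, ‖A n‖) ^ 2)).mono' (by fun_prop)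
    (Eventually.of_forall fun t => ?_)
  rw [Real.norm_of_nonneg (by positivity)]
  gcongr
  refine (norm_sum_le _ _).trans (Finset.sum_le_sum fun n _ => ?_)
  rw [norm_mul, mul_comm Complex.I, Complex.norm_exp_ofReal_mul_I, mul_one]

theorem norm_freqLocFun_le (S : Finset (Fin 3 → ℤ)) (c : (Fin 3 → ℤ) → ℝ → ℂ) (t : ℝ)
    (x : Fin 3 → ℝ) : ‖freqLocFun S c t x‖ ≤ ∑ n ∈ S, ‖c n t‖ := by
  refine (norm_sum_le _ _).trans (Finset.sum_le_sum fun n _ => ?_)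
  rw [norm_mul, mul_comm Complex.I, Complex.norm_exp_ofReal_mul_I, mul_one]

/-- The time density, weighted by `exp (-|t|)`, of the contribution of the spatial frequency `m`
to the fourth power of the `L⁴`-norm of a free evolution. -/
noncomputable def outputDensity (S : Finset (Fin 3 → ℤ)) (σ : ℝ) (a : (Fin 3 → ℤ) → ℂ)
    (m : Fin 3 → ℤ) (t : ℝ) : ℝ :=
  Real.exp (-|t|) * ‖∑ n ∈ S with m - n ∈ S, (a n * a (m - n)) *
    Complex.exp (Complex.I * ((σ * (jbZ n + jbZ (m - n)) * t : ℝ) : ℂ))‖ ^ 2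

theorem outputDensity_nonneg (S : Finset (Fin 3 → ℤ)) (σ : ℝ) (a : (Fin 3 → ℤ) → ℂ)
    (m : Fin 3 → ℤ) (t : ℝ) : 0 ≤ outputDensity S σ a m t := by
  unfold outputDensity; positivity

theorem integrable_outputDensity (S : Finset (Fin 3 → ℤ)) (σ : ℝ) (a : (Fin 3 → ℤ) → ℂ)
    (m : Fin 3 → ℤ) : Integrable (outputDensity S σ a m) :=
  integrable_exp_neg_abs_mul_norm_sq _ _ _

theorem lintegral_cube_freqLocFun_freeCoeff (S : Finset (Fin 3 → ℤ)) (σ : ℝ)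
    (a : (Fin 3 → ℤ) → ℂ) (t : ℝ) :
    ∫⁻ x in cube, ‖freqLocFun S (freeCoeff σ a) t x‖ₑ ^ 4 =
      ENNReal.ofReal (Real.exp |t| * ((2 * Real.pi) ^ 3 *
        ∑ m ∈ Finset.image₂ (· + ·) S S, outputDensity S σ a m t)) := by
  have hpair : Continuous fun x : Fin 3 → ℝ => (t, x) := Continuous.prodMk_right t
  have hc := (continuous_freqLocFun_freeCoeff S σ a).comp hpair
  simp only [Function.comp_def] at hc
  have hint : Integrable (fun x : Fin 3 → ℝ => ‖freqLocFun S (freeCoeff σ a) t x‖ ^ 4)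
      (volume.restrict cube) := by
    refine Integrable.of_bound (C := (∑ n ∈ S, ‖freeCoeff σ a n t‖) ^ 4)
      (hc.norm.pow 4).aestronglyMeasurable (Eventually.of_forall fun x => ?_)
    rw [Real.norm_of_nonneg (by positivity)]
    exact pow_le_pow_left₀ (norm_nonneg _) (norm_freqLocFun_le _ _ _ _) 4
  have : ∀ x, ‖freqLocFun S (freeCoeff σ a) t x‖ₑ ^ 4 =
      ENNReal.ofReal (‖freqLocFun S (freeCoeff σ a) t x‖ ^ 4) := by
    intro x
    rw [ENNReal.ofReal_pow (norm_nonneg _), ofReal_norm]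
  simp_rw [this]
  rw [← ofReal_integral_eq_lintegral_ofReal hint (Eventually.of_forall fun x => by positivity)]
  congr 1
  unfold freqLocFun
  rw [integral_cube_norm_pow_four S fun n => freeCoeff σ a n t]
  simp_rw [freeCoeff_mul_freeCoeff, outputDensity]
  rw [← Finset.mul_sum, mul_left_comm _ (Real.exp (-|t|)), ← mul_assoc, ← Real.exp_add,
    add_neg_cancel, Real.exp_zero, one_mul]

theorem lintegral_freqLocFun_freeCoeff_le_of_resonance {S : Finset (Fin 3 → ℤ)} {T σ G : ℝ}
    (hG : ∀ m n, ∑ n' ∈ S with m - n' ∈ S,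
      (1 + (σ * (jbZ n' + jbZ (m - n')) - σ * (jbZ n + jbZ (m - n))) ^ 2)⁻¹ ≤ G)
    (a : (Fin 3 → ℤ) → ℂ) :
    ∫⁻ q in Set.Icc 0 T ×ˢ cube, ‖freqLocFun S (freeCoeff σ a) q.1 q.2‖ₑ ^ 4 ≤
      ENNReal.ofReal (Real.exp T * ((2 * Real.pi) ^ 3 * (2 * G *
        (∑ n ∈ S, ‖a n‖ ^ 2) ^ 2))) := by
  have hPle : ∀ m, ∫ t, outputDensity S σ a m t ≤ 2 * G *
      ∑ n ∈ S with m - n ∈ S, ‖a n‖ ^ 2 * ‖a (m - n)‖ ^ 2 := by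
    intro m
    refine (integral_exp_neg_abs_mul_norm_sq_le fun n _ => hG m n).trans_eq ?_
    simp_rw [norm_mul, mul_pow]
  have hsum : ∑ m ∈ Finset.image₂ (· + ·) S S, ∑ n ∈ S with m - n ∈ S,
      ‖a n‖ ^ 2 * ‖a (m - n)‖ ^ 2 = (∑ n ∈ S, ‖a n‖ ^ 2) ^ 2 := by
    rw [sq, Finset.sum_mul_sum, sum_sum_eq_sum_sub]
  have hspace := lintegral_cube_freqLocFun_freeCoeff S σ a
  generalize Finset.image₂ (· + ·) S S = M at *
  have hPsum : Integrable fun t => ∑ m ∈ M, outputDensity S σ a m t :=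
    integrable_finsetSum _ fun m _ => integrable_outputDensity S σ a m
  have hPsum0 : ∀ t, 0 ≤ ∑ m ∈ M, outputDensity S σ a m t :=
    fun t => Finset.sum_nonneg fun m _ => outputDensity_nonneg S σ a m t
  calc ∫⁻ q in Set.Icc 0 T ×ˢ cube, ‖freqLocFun S (freeCoeff σ a) q.1 q.2‖ₑ ^ 4
      = ∫⁻ t in Set.Icc 0 T, ∫⁻ x in cube, ‖freqLocFun S (freeCoeff σ a) t x‖ₑ ^ 4 := by
        rw [Measure.volume_eq_prod, ← Measure.prod_restrict, lintegral_prod]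
        exact ((continuous_freqLocFun_freeCoeff S σ a).enorm.measurable.pow_const 4).aemeasurable
    _ ≤ ∫⁻ t in Set.Icc 0 T, ENNReal.ofReal (Real.exp T * ((2 * Real.pi) ^ 3 *
          ∑ m ∈ M, outputDensity S σ a m t)) := by
        refine setLIntegral_mono' measurableSet_Icc fun t ht => ?_
        rw [hspace]
        have h0 := hPsum0 t
        have h1 : Real.exp |t| ≤ Real.exp T := by
          rw [abs_of_nonneg ht.1]; exact Real.exp_le_exp.2 ht.2
        exact ENNReal.ofReal_le_ofReal (mul_le_mul_of_nonneg_right h1 (by positivity))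
    _ ≤ ∫⁻ t, ENNReal.ofReal (Real.exp T * ((2 * Real.pi) ^ 3 *
          ∑ m ∈ M, outputDensity S σ a m t)) :=
        setLIntegral_le_lintegral _ _
    _ = ENNReal.ofReal (Real.exp T * ((2 * Real.pi) ^ 3 *
          ∑ m ∈ M, ∫ t, outputDensity S σ a m t)) := by
        rw [← ofReal_integral_eq_lintegral_ofReal ((hPsum.const_mul _).const_mul _)
          (Eventually.of_forall fun t => by have := hPsum0 t; positivity),
          integral_const_mul, integral_const_mul,
          integral_finsetSum _ fun m _ => integrable_outputDensity S σ a m]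
    _ ≤ _ := by
        refine ENNReal.ofReal_le_ofReal ?_
        have := Finset.sum_le_sum fun m (_ : m ∈ M) => hPle m
        rw [← Finset.mul_sum, hsum] at this
        gcongr

/-- The constant in the linear `L⁴` Strichartz estimate on the time interval `[0, T]`. -/
noncomputable def strichartzConst (T : ℝ) : ℝ :=
  Real.exp T * (2 * Real.pi) ^ 3 * (2 * resonanceConst)

theorem strichartzConst_nonneg (T : ℝ) : 0 ≤ strichartzConst T := by
  have := resonanceConst_nonneg
  unfold strichartzConst; positivity

theorem lintegral_freqLocFun_freeCoeff_le {T N σ : ℝ} (hN : 1 ≤ N) (hσ : σ ^ 2 = 1)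
    (a : (Fin 3 → ℤ) → ℂ) :
    ∫⁻ q in Set.Icc 0 T ×ˢ cube, ‖freqLocFun (annulus N) (freeCoeff σ a) q.1 q.2‖ₑ ^ 4 ≤
      ENNReal.ofReal (strichartzConst T * N ^ 2 * (∑ n ∈ annulus N, ‖a n‖ ^ 2) ^ 2) := by
  refine (lintegral_freqLocFun_freeCoeff_le_of_resonance
    (fun m n => sum_resonance_le hN hσ m n) a).trans_eq ?_
  unfold strichartzConst
  ring_nf

section Variation
variable {B : Type*} [NormedAddCommGroup B] {p : ℝ} {v : ℝ → B}

theorem sum_rpow_le_VpNorm (hp : 1 ≤ p) (hv : VpNorm p v ≠ ⊤) {K : ℕ} {t : Fin (K + 1) → EReal}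
    (ht : StrictMono t) (hbot : ∀ i, t i ≠ ⊥) :
    ∑ i : Fin K, ‖extEReal v (t i.succ) - extEReal v (t i.castSucc)‖ ^ p ≤
      (VpNorm p v).toReal ^ p := by
  have hp0 : 0 < p := by linarith
  have h0 : 0 ≤ ∑ i : Fin K, ‖extEReal v (t i.succ) - extEReal v (t i.castSucc)‖ ^ p :=
    Finset.sum_nonneg fun i _ => by positivity
  have hle : ENNReal.ofReal ((∑ i : Fin K,
      ‖extEReal v (t i.succ) - extEReal v (t i.castSucc)‖ ^ p) ^ (1 / p)) ≤ VpNorm p v :=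
    le_iSup₂_of_le K t (le_iSup₂_of_le ht hbot le_rfl)
  rw [ENNReal.ofReal_le_iff_le_toReal hv] at hle
  have := Real.rpow_le_rpow (by positivity) hle hp0.le
  rwa [← Real.rpow_mul h0, one_div_mul_cancel hp0.ne', Real.rpow_one] at this

theorem extEReal_coe (v : ℝ → B) (t : ℝ) : extEReal v t = v t := by
  simp [extEReal]

theorem norm_le_VpNorm (hp : 1 ≤ p) (hv : VpNorm p v ≠ ⊤) (t : ℝ) :
    ‖v t‖ ≤ (VpNorm p v).toReal := by
  have h := sum_rpow_le_VpNorm hp hv (K := 1) (t := ![(t : EReal), ⊤])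
    (by rw [Fin.strictMono_iff_lt_succ]; intro i; fin_cases i; simp)
    (by intro i; fin_cases i <;> simp)
  simp only [Finset.univ_unique, Fin.default_eq_zero, Finset.sum_singleton] at h
  have h1 : extEReal v (![(t : EReal), ⊤] (Fin.succ 0)) = 0 := by simp [extEReal]
  have h2 : extEReal v (![(t : EReal), ⊤] (Fin.castSucc 0)) = v t := extEReal_coe v t
  rw [h1, h2, zero_sub, norm_neg] at h
  exact (Real.rpow_le_rpow_iff (norm_nonneg _) ENNReal.toReal_nonneg (by linarith)).1 h

/-- The values of the `p`-variation sums of `v` over the real partitions that end at `t`. -/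
def variationSums (p : ℝ) (v : ℝ → B) (t : ℝ) : Set ℝ :=
  {r | ∃ (K : ℕ) (u : Fin (K + 1) → ℝ), StrictMono u ∧ u (Fin.last K) = t ∧
    r = ∑ i : Fin K, ‖v (u i.succ) - v (u i.castSucc)‖ ^ p}

/-- The `p`-th power of the `p`-variation of `v` on `(-∞, t]`. -/
noncomputable def variationUpTo (p : ℝ) (v : ℝ → B) (t : ℝ) : ℝ := sSup (variationSums p v t)

theorem zero_mem_variationSums (p : ℝ) (v : ℝ → B) (t : ℝ) : 0 ∈ variationSums p v t :=
  ⟨0, fun _ => t, fun i j hij => absurd hij (by simp [Subsingleton.elim (α := Fin 1) i j]), rfl,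
    by simp⟩

theorem le_of_mem_variationSums (hp : 1 ≤ p) (hv : VpNorm p v ≠ ⊤) {t r : ℝ}
    (hr : r ∈ variationSums p v t) : r ≤ (VpNorm p v).toReal ^ p := by
  obtain ⟨K, u, hu, -, rfl⟩ := hr
  have h := sum_rpow_le_VpNorm hp hv (t := fun i => (u i : EReal))
    (fun i j hij => EReal.coe_lt_coe_iff.2 (hu hij)) (fun i => EReal.coe_ne_bot _)
  simpa only [extEReal_coe] using h

theorem bddAbove_variationSums (hp : 1 ≤ p) (hv : VpNorm p v ≠ ⊤) (t : ℝ) :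
    BddAbove (variationSums p v t) :=
  ⟨_, fun _ hr => le_of_mem_variationSums hp hv hr⟩

theorem variationUpTo_nonneg (hp : 1 ≤ p) (hv : VpNorm p v ≠ ⊤) (t : ℝ) :
    0 ≤ variationUpTo p v t :=
  le_csSup (bddAbove_variationSums hp hv t) (zero_mem_variationSums p v t)

theorem variationUpTo_le (hp : 1 ≤ p) (hv : VpNorm p v ≠ ⊤) (t : ℝ) :
    variationUpTo p v t ≤ (VpNorm p v).toReal ^ p :=
  csSup_le ⟨0, zero_mem_variationSums p v t⟩ fun _ hr => le_of_mem_variationSums hp hv hr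

theorem variationUpTo_add_le (hp : 1 ≤ p) (hv : VpNorm p v ≠ ⊤) {s t : ℝ} (hst : s < t) :
    variationUpTo p v s + ‖v t - v s‖ ^ p ≤ variationUpTo p v t := by
  rw [← le_sub_iff_add_le]
  refine csSup_le ⟨0, zero_mem_variationSums p v s⟩ fun r hr => ?_
  obtain ⟨K, u, hu, hlast, rfl⟩ := hr
  rw [le_sub_iff_add_le]
  refine le_csSup (bddAbove_variationSums hp hv t)
    ⟨K + 1, Fin.snoc (α := fun _ => ℝ) u t, ?_, by simp, ?_⟩
  · rw [Fin.strictMono_iff_lt_succ]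
    intro i
    induction i using Fin.lastCases with
    | last => simpa [hlast] using hst
    | cast i =>
      rw [Fin.succ_castSucc, Fin.snoc_castSucc, Fin.snoc_castSucc]
      exact hu Fin.castSucc_lt_succ
  · rw [Fin.sum_univ_castSucc]
    congr 1
    · refine Finset.sum_congr rfl fun i _ => ?_
      rw [Fin.succ_castSucc, Fin.snoc_castSucc, Fin.snoc_castSucc]
    · rw [Fin.succ_last, Fin.snoc_last, Fin.snoc_castSucc, hlast]

theorem monotone_variationUpTo (hp : 1 ≤ p) (hv : VpNorm p v ≠ ⊤) :
    Monotone (variationUpTo p v) := by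
  intro s t hst
  rcases hst.eq_or_lt with rfl | h
  · rfl
  · have := variationUpTo_add_le hp hv h
    have : 0 ≤ ‖v t - v s‖ ^ p := by positivity
    linarith

theorem norm_sub_rpow_le_abs_variationUpTo (hp : 1 ≤ p) (hv : VpNorm p v ≠ ⊤) (s t : ℝ) :
    ‖v t - v s‖ ^ p ≤ |variationUpTo p v t - variationUpTo p v s| := by
  rcases lt_trichotomy s t with h | rfl | h
  · exact le_trans (by linarith [variationUpTo_add_le hp hv h]) (le_abs_self _)
  · simp [Real.zero_rpow (by linarith : p ≠ 0)]
  · rw [norm_sub_rev, abs_sub_comm]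
    exact le_trans (by linarith [variationUpTo_add_le hp hv h]) (le_abs_self _)

/-- A function of finite `p`-variation is approximated by step functions with `2 ^ j + 1` values,
subordinate to nested partitions, up to a uniform error of size `2 ^ (-j / p)`. -/
theorem exists_step_approximation (hp : 1 ≤ p) (hv : VpNorm p v ≠ ⊤)
    (hA : 0 < (VpNorm p v).toReal) :
    ∃ (ℓ : ℕ → ℝ → ℕ) (g : ℕ → ℕ → B), (∀ j, Measurable (ℓ j)) ∧ (∀ j t, ℓ j t < 2 ^ j + 1) ∧
      (∀ j t t', ℓ (j + 1) t = ℓ (j + 1) t' → ℓ j t = ℓ j t') ∧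
      (∀ j k, ‖g j k‖ ≤ (VpNorm p v).toReal) ∧
      ∀ j t, ‖v t - g j (ℓ j t)‖ ≤ (VpNorm p v).toReal * ((2 : ℝ) ^ (-(1 / p))) ^ j := by
  set A := (VpNorm p v).toReal
  have hp0 : 0 < p := by linarith
  have hAp : 0 < A ^ p := by positivity
  let ℓ : ℕ → ℝ → ℕ := fun j t => ⌊2 ^ j * (variationUpTo p v t / A ^ p)⌋₊
  have h0 : ∀ t, 0 ≤ variationUpTo p v t / A ^ p :=
    fun t => div_nonneg (variationUpTo_nonneg hp hv t) hAp.le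
  have h1 : ∀ t, variationUpTo p v t / A ^ p ≤ 1 :=
    fun t => (div_le_one hAp).2 (variationUpTo_le hp hv t)
  let rep : ℕ → ℕ → ℝ := fun j => Function.invFun (ℓ j)
  have hrep : ∀ j t, ℓ j (rep j (ℓ j t)) = ℓ j t :=
    fun j t => Function.invFun_eq ⟨t, rfl⟩
  refine ⟨ℓ, fun j k => v (rep j k), fun j => ?_, fun j t => ?_, fun j t t' h => ?_,
    fun j k => norm_le_VpNorm hp hv _, fun j t => ?_⟩
  · exact Nat.measurable_floor.comp
      (((monotone_variationUpTo hp hv).measurable.div_const _).const_mul _)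
  · rw [Nat.lt_add_one_iff]
    refine Nat.floor_le_of_le ?_
    push_cast
    exact mul_le_of_le_one_right (by positivity) (h1 t)
  · have key : ∀ t, ℓ j t = ℓ (j + 1) t / 2 := by
      intro t
      have := Nat.floor_div_natCast (2 ^ (j + 1) * (variationUpTo p v t / A ^ p)) 2
      change ⌊2 ^ j * (variationUpTo p v t / A ^ p)⌋₊ = _ / 2
      rw [← this]
      congr 1
      push_cast
      ring
    rw [key, key, h]
  · have hfl := hrep j t
    set s := rep j (ℓ j t)
    have hpow : (0 : ℝ) < 2 ^ j := by positivity
    have hs1 := Nat.floor_le (mul_nonneg hpow.le (h0 s))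
    have hs2 := Nat.lt_floor_add_one (2 ^ j * (variationUpTo p v s / A ^ p))
    have ht1 := Nat.floor_le (mul_nonneg hpow.le (h0 t))
    have ht2 := Nat.lt_floor_add_one (2 ^ j * (variationUpTo p v t / A ^ p))
    change ⌊2 ^ j * (variationUpTo p v s / A ^ p)⌋₊ =
      ⌊2 ^ j * (variationUpTo p v t / A ^ p)⌋₊ at hfl
    rw [hfl] at hs1 hs2
    have habs : |2 ^ j * (variationUpTo p v t / A ^ p) - 2 ^ j * (variationUpTo p v s / A ^ p)| ≤
        1 := abs_le.2 ⟨by linarith, by linarith⟩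
    have hvar : |variationUpTo p v t - variationUpTo p v s| ≤ A ^ p * (2 ^ j)⁻¹ := by
      rw [← mul_sub, ← sub_div, abs_mul, abs_div, abs_of_pos hpow, abs_of_pos hAp] at habs
      rw [← div_eq_mul_inv, le_div_iff₀ hpow]
      rw [mul_div_assoc', div_le_one hAp] at habs
      linarith
    have hfin := (norm_sub_rpow_le_abs_variationUpTo hp hv s t).trans hvar
    have hrhs : (A * ((2 : ℝ) ^ (-(1 / p))) ^ j) ^ p = A ^ p * (2 ^ j)⁻¹ := by
      have h2 : ((2 : ℝ) ^ (-(1 / p))) ^ p = 2⁻¹ := by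
        rw [← Real.rpow_mul (by norm_num), neg_mul, one_div_mul_cancel hp0.ne',
          Real.rpow_neg_one]
      rw [Real.mul_rpow hA.le (by positivity), ← Real.rpow_pow_comm (by positivity), h2, inv_pow]
    rw [← hrhs] at hfin
    exact (Real.rpow_le_rpow_iff (norm_nonneg _) (by positivity) hp0).1 hfin

end Variation

section Transfer
variable {S : Finset (Fin 3 → ℤ)} {σ : ℝ}

/-- Extension by zero of an element of `ℓ²(S)` to the whole lattice. -/
noncomputable def extendZero (w : EuclideanSpace ℂ ↥S) (n : Fin 3 → ℤ) : ℂ :=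
  if h : n ∈ S then w ⟨n, h⟩ else 0

theorem extendZero_coe (w : EuclideanSpace ℂ ↥S) (n : ↥S) : extendZero w n = w n := by
  simp [extendZero]

theorem sum_norm_extendZero_sq (w : EuclideanSpace ℂ ↥S) :
    ∑ n ∈ S, ‖extendZero w n‖ ^ 2 = ‖w‖ ^ 2 := by
  rw [EuclideanSpace.norm_sq_eq, ← Finset.sum_coe_sort S]
  simp only [extendZero_coe]

theorem norm_extendZero_le (w : EuclideanSpace ℂ ↥S) (n : Fin 3 → ℤ) :
    ‖extendZero w n‖ ≤ ‖w‖ := by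
  unfold extendZero
  split_ifs with h
  · exact PiLp.norm_apply_le w _
  · simp

theorem extendZero_sub (w w' : EuclideanSpace ℂ ↥S) (n : Fin 3 → ℤ) :
    extendZero (w - w') n = extendZero w n - extendZero w' n := by
  unfold extendZero
  split_ifs <;> simp

/-- The space-time function with modulated coefficient curve `v`. -/
noncomputable def evolve (S : Finset (Fin 3 → ℤ)) (σ : ℝ) (v : ℝ → EuclideanSpace ℂ ↥S)
    (q : ℝ × (Fin 3 → ℝ)) : ℂ :=
  freqLocFun S (freeCoeff σ (extendZero (v q.1))) q.1 q.2

theorem evolve_sub (v w : ℝ → EuclideanSpace ℂ ↥S) :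
    evolve S σ (v - w) = evolve S σ v - evolve S σ w := by
  funext q
  simp only [evolve, freqLocFun, freeCoeff, Pi.sub_apply, extendZero_sub, mul_sub, sub_mul,
    Finset.sum_sub_distrib]

theorem evolve_modCurve (c : (Fin 3 → ℤ) → ℝ → ℂ) :
    evolve S σ (modCurve S σ c) = fun q => freqLocFun S c q.1 q.2 := by
  funext q
  refine Finset.sum_congr rfl fun n hn => ?_
  have h : extendZero (modCurve S σ c q.1) n =
      Complex.exp (-(Complex.I * ((σ * jbZ n * q.1 : ℝ) : ℂ))) * c n q.1 :=
    extendZero_coe _ (⟨n, hn⟩ : ↥S)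
  rw [freeCoeff, h, ← mul_assoc, ← Complex.exp_add, add_neg_cancel, Complex.exp_zero, one_mul]

theorem measurable_freqLocFun {c : (Fin 3 → ℤ) → ℝ → ℂ} (hc : ∀ n, Measurable (c n)) :
    Measurable fun q : ℝ × (Fin 3 → ℝ) => freqLocFun S c q.1 q.2 := by
  unfold freqLocFun
  refine Finset.measurable_sum _ fun n _ => ?_
  have h1 : Measurable fun q : ℝ × (Fin 3 → ℝ) => c n q.1 := (hc n).comp measurable_fst
  have h2 : Measurable fun q : ℝ × (Fin 3 → ℝ) => dotZ n q.2 :=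
    (continuous_dotZ n).measurable.comp measurable_snd
  fun_prop

theorem measurable_evolve {v : ℝ → EuclideanSpace ℂ ↥S}
    (hv : ∀ n, Measurable fun t => extendZero (v t) n) : Measurable (evolve S σ v) := by
  have h : evolve S σ v =
      fun q => freqLocFun S (fun n t => freeCoeff σ (extendZero (v t)) n t) q.1 q.2 := rfl
  rw [h]
  refine measurable_freqLocFun fun n => ?_
  have := hv n
  unfold freeCoeff
  fun_prop

theorem norm_evolve_le (v : ℝ → EuclideanSpace ℂ ↥S) (q : ℝ × (Fin 3 → ℝ)) :
    ‖evolve S σ v q‖ ≤ S.card * ‖v q.1‖ := by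
  refine (norm_freqLocFun_le S _ _ _).trans ?_
  rw [← nsmul_eq_mul]
  refine Finset.sum_le_card_nsmul _ _ _ fun n _ => ?_
  rw [freeCoeff, norm_mul, mul_comm Complex.I, Complex.norm_exp_ofReal_mul_I, one_mul]
  exact norm_extendZero_le _ _

theorem eLpNorm_four_le {α : Type*} [MeasurableSpace α] {μ : Measure α} {f : α → ℂ} {X : ℝ}
    (hX : 0 ≤ X) (h : ∫⁻ x, ‖f x‖ₑ ^ 4 ∂μ ≤ ENNReal.ofReal (X ^ 4)) :
    eLpNorm f 4 μ ≤ ENNReal.ofReal X := by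
  rw [eLpNorm_eq_lintegral_rpow_enorm_toReal (by norm_num) (by norm_num), ENNReal.toReal_ofNat]
  have h4 : ∀ y : ℝ≥0∞, y ^ (4 : ℝ) = y ^ 4 := fun y => by
    rw [← ENNReal.rpow_natCast]; norm_num
  simp only [h4]
  rw [one_div, ENNReal.rpow_inv_le_iff (by norm_num), h4, ← ENNReal.ofReal_pow hX]
  exact h

variable {μ : Measure (ℝ × (Fin 3 → ℝ))} {Q : ℝ}

/-- An `L⁴` bound for free evolutions, applied on each of the `L` pieces of a step function. -/
theorem eLpNorm_evolve_step_le
    (hS : ∀ a : (Fin 3 → ℤ) → ℂ, ∫⁻ q, ‖freqLocFun S (freeCoeff σ a) q.1 q.2‖ₑ ^ 4 ∂μ ≤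
      ENNReal.ofReal (Q * (∑ n ∈ S, ‖a n‖ ^ 2) ^ 2)) (hQ : 0 ≤ Q)
    {v : ℝ → EuclideanSpace ℂ ↥S} {ℓ : ℝ → ℕ} {L : ℕ} {D X : ℝ} (hℓ : ∀ t, ℓ t < L)
    (hv : ∀ t t', ℓ t = ℓ t' → v t = v t') (hD : ∀ t, ‖v t‖ ≤ D) (hX : 0 ≤ X)
    (hLX : L * (Q * D ^ 4) ≤ X ^ 4) :
    eLpNorm (evolve S σ v) 4 μ ≤ ENNReal.ofReal X := by
  refine eLpNorm_four_le hX ?_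
  let f : ℕ → (Fin 3 → ℤ) → ℂ := fun k => extendZero (v (Function.invFun ℓ k))
  have hf : ∀ t, f (ℓ t) = extendZero (v t) := fun t =>
    congrArg extendZero (hv _ _ (Function.invFun_eq ⟨t, rfl⟩))
  calc ∫⁻ q, ‖evolve S σ v q‖ₑ ^ 4 ∂μ
      ≤ ∫⁻ q, ∑ k ∈ Finset.range L, ‖freqLocFun S (freeCoeff σ (f k)) q.1 q.2‖ₑ ^ 4 ∂μ := by
        refine lintegral_mono fun q => ?_
        have h := Finset.single_le_sum
          (f := fun k => ‖freqLocFun S (freeCoeff σ (f k)) q.1 q.2‖ₑ ^ 4)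
          (fun _ _ => zero_le) (Finset.mem_range.2 (hℓ q.1))
        simp only [hf] at h
        exact h
    _ = ∑ k ∈ Finset.range L, ∫⁻ q, ‖freqLocFun S (freeCoeff σ (f k)) q.1 q.2‖ₑ ^ 4 ∂μ :=
        lintegral_finsetSum _ fun k _ =>
          (continuous_freqLocFun_freeCoeff S σ (f k)).measurable.enorm.pow_const 4
    _ ≤ ∑ k ∈ Finset.range L, ENNReal.ofReal (Q * D ^ 4) := by
        refine Finset.sum_le_sum fun k _ => (hS _).trans (ENNReal.ofReal_le_ofReal ?_)
        rw [sum_norm_extendZero_sq, ← pow_mul]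
        have := hD (Function.invFun ℓ k)
        gcongr
    _ = ENNReal.ofReal (L * (Q * D ^ 4)) := by
        rw [Finset.sum_const, Finset.card_range, nsmul_eq_mul,
          ENNReal.ofReal_mul (Nat.cast_nonneg L), ENNReal.ofReal_natCast]
    _ ≤ ENNReal.ofReal (X ^ 4) := ENNReal.ofReal_le_ofReal hLX

/-- Transfer of an `L⁴` bound from free evolutions to functions of finite `p`-variation, `p < 4`. -/
theorem eLpNorm_evolve_le_VpNorm [IsFiniteMeasure μ]
    (hS : ∀ a : (Fin 3 → ℤ) → ℂ, ∫⁻ q, ‖freqLocFun S (freeCoeff σ a) q.1 q.2‖ₑ ^ 4 ∂μ ≤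
      ENNReal.ofReal (Q ^ 4 * (∑ n ∈ S, ‖a n‖ ^ 2) ^ 2)) (hQ : 0 ≤ Q) {p r : ℝ} (hp : 1 ≤ p)
    (hr : r = (2 : ℝ) ^ ((1 : ℝ) / 4) * (2 : ℝ) ^ (-(1 / p))) (hr1 : r < 1)
    {v : ℝ → EuclideanSpace ℂ ↥S} (hv : VpNorm p v ≠ ⊤)
    (hmeas : AEStronglyMeasurable (evolve S σ v) μ) :
    eLpNorm (evolve S σ v) 4 μ ≤
      ENNReal.ofReal (4 * Q * (1 + (1 - r)⁻¹) * (VpNorm p v).toReal) := by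
  set A := (VpNorm p v).toReal with hAdef
  have hr0 : 0 < r := by rw [hr]; positivity
  rcases (ENNReal.toReal_nonneg : 0 ≤ A).eq_or_lt with hA | hA
  · have h0 : evolve S σ v = 0 := by
      funext q
      have h1 : ‖v q.1‖ ≤ 0 := (norm_le_VpNorm hp hv _).trans hA.ge
      have h2 := norm_evolve_le (σ := σ) v q
      rw [le_antisymm h1 (norm_nonneg _), mul_zero] at h2
      exact norm_le_zero_iff.1 h2
    simp [h0]
  obtain ⟨ℓ, g, hℓm, hℓ, hnest, hg, happ⟩ := exists_step_approximation hp hv hA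
  set θ : ℝ := (2 : ℝ) ^ (-(1 / p)) with hθ
  have hθ0 : 0 < θ := by positivity
  have hθ1 : θ < 1 := Real.rpow_lt_one_of_one_lt_of_neg (by norm_num)
    (neg_neg_of_pos (by positivity))
  have hr4 : r ^ 4 = 2 * θ ^ 4 := by
    rw [hr, mul_pow, ← Real.rpow_natCast (2 ^ ((1 : ℝ) / 4)), ← Real.rpow_mul (by norm_num)]
    norm_num
  let w : ℕ → ℝ → EuclideanSpace ℂ ↥S := fun j t => g j (ℓ j t)
  have hwm : ∀ j, AEStronglyMeasurable (evolve S σ (w j)) μ := fun j =>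
    (measurable_evolve fun n =>
      (Measurable.of_discrete (f := fun k => extendZero (g j k) n)).comp
        (hℓm j)).aestronglyMeasurable
  have hstep : ∀ j, eLpNorm (evolve S σ (w (j + 1) - w j)) 4 μ ≤
      ENNReal.ofReal (4 * Q * A * r ^ j) := by
    intro j
    refine eLpNorm_evolve_step_le hS (by positivity) (D := 2 * A * θ ^ j) (hℓ (j + 1))
      (fun t t' h => ?_) (fun t => ?_) (by positivity) ?_
    · simp only [w, Pi.sub_apply, h, hnest j t t' h]
    · have h1 := happ (j + 1) t
      have h2 := happ j t
      have h3 : A * θ ^ (j + 1) ≤ A * θ ^ j :=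
        mul_le_mul_of_nonneg_left (pow_le_pow_of_le_one hθ0.le hθ1.le (Nat.le_succ j)) hA.le
      calc ‖(w (j + 1) - w j) t‖
          = ‖(v t - g j (ℓ j t)) - (v t - g (j + 1) (ℓ (j + 1) t))‖ := by
            congr 1; simp only [w, Pi.sub_apply]; abel
        _ ≤ A * θ ^ j + A * θ ^ (j + 1) := (norm_sub_le _ _).trans (add_le_add h2 h1)
        _ ≤ 2 * A * θ ^ j := by linarith
    · have h1 : (1 : ℝ) ≤ 2 ^ j := one_le_pow₀ (by norm_num)
      have h2 : (((2 ^ (j + 1) + 1 : ℕ)) : ℝ) ≤ 16 * 2 ^ j := by push_cast; rw [pow_succ]; linarith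
      have h3 : (r ^ j) ^ 4 = 2 ^ j * (θ ^ j) ^ 4 := by
        rw [← pow_mul, mul_comm j 4, pow_mul, hr4, mul_pow, ← pow_mul, ← pow_mul, mul_comm j 4]
      calc (((2 ^ (j + 1) + 1 : ℕ)) : ℝ) * (Q ^ 4 * (2 * A * θ ^ j) ^ 4)
          ≤ 16 * 2 ^ j * (Q ^ 4 * (2 * A * θ ^ j) ^ 4) := by gcongr
        _ = 256 * Q ^ 4 * A ^ 4 * (2 ^ j * (θ ^ j) ^ 4) := by ring
        _ = (4 * Q * A * r ^ j) ^ 4 := by rw [← h3]; ring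
  have hsum : ∀ J, eLpNorm (evolve S σ (w J)) 4 μ ≤
      ENNReal.ofReal (4 * Q * A * (1 + ∑ j ∈ Finset.range J, r ^ j)) := by
    intro J
    induction J with
    | zero =>
      refine eLpNorm_evolve_step_le hS (by positivity) (D := A) (hℓ 0)
        (fun t t' h => ?_) (fun t => hg _ _) (by positivity) ?_
      · simp only [w, h]
      · simp only [Finset.range_zero, Finset.sum_empty]
        have : 0 ≤ Q ^ 4 * A ^ 4 := by positivity
        norm_num
        nlinarith
    | succ J ih =>
      have h1 : evolve S σ (w (J + 1)) = evolve S σ (w J) + evolve S σ (w (J + 1) - w J) := by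
        rw [evolve_sub]; abel
      have h2 : AEStronglyMeasurable (evolve S σ (w (J + 1) - w J)) μ := by
        rw [evolve_sub]; exact (hwm _).sub (hwm _)
      rw [h1]
      refine (eLpNorm_add_le (hwm J) h2 (by norm_num)).trans
        ((add_le_add ih (hstep J)).trans_eq ?_)
      rw [← ENNReal.ofReal_add (by positivity) (by positivity), Finset.sum_range_succ]
      congr 1
      ring
  have hgeom : ∀ J, ∑ j ∈ Finset.range J, r ^ j ≤ (1 - r)⁻¹ := fun J =>
    (Summable.sum_le_tsum _ (fun _ _ => by positivity)
      (summable_geometric_of_lt_one hr0.le hr1)).trans_eq (tsum_geometric_of_lt_one hr0.le hr1)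
  have hrem : ∀ J, eLpNorm (evolve S σ (v - w J)) 4 μ ≤
      μ Set.univ ^ ((4 : ℝ≥0∞).toReal)⁻¹ * ENNReal.ofReal (S.card * (A * θ ^ J)) := by
    intro J
    refine eLpNorm_le_of_ae_bound (Eventually.of_forall fun q => ?_)
    refine (norm_evolve_le _ _).trans ?_
    exact mul_le_mul_of_nonneg_left (happ J q.1) (Nat.cast_nonneg _)
  have hbound : ∀ J, eLpNorm (evolve S σ v) 4 μ ≤
      ENNReal.ofReal (4 * Q * (1 + (1 - r)⁻¹) * A) +
        μ Set.univ ^ ((4 : ℝ≥0∞).toReal)⁻¹ * ENNReal.ofReal (S.card * (A * θ ^ J)) := by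
    intro J
    have h1 : evolve S σ v = evolve S σ (w J) + evolve S σ (v - w J) := by
      rw [evolve_sub]; abel
    have h2 : AEStronglyMeasurable (evolve S σ (v - w J)) μ := by
      rw [evolve_sub]; exact hmeas.sub (hwm _)
    rw [h1]
    refine (eLpNorm_add_le (hwm J) h2 (by norm_num)).trans (add_le_add ((hsum J).trans
      (ENNReal.ofReal_le_ofReal ?_)) (hrem J))
    have := hgeom J
    calc 4 * Q * A * (1 + ∑ j ∈ Finset.range J, r ^ j) ≤ 4 * Q * A * (1 + (1 - r)⁻¹) := by gcongr
      _ = _ := by ring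
  have hlim : Tendsto (fun J : ℕ => ENNReal.ofReal (4 * Q * (1 + (1 - r)⁻¹) * A) +
      μ Set.univ ^ ((4 : ℝ≥0∞).toReal)⁻¹ * ENNReal.ofReal (S.card * (A * θ ^ J))) atTop
      (nhds (ENNReal.ofReal (4 * Q * (1 + (1 - r)⁻¹) * A) +
        μ Set.univ ^ ((4 : ℝ≥0∞).toReal)⁻¹ * ENNReal.ofReal (S.card * (A * 0)))) := by
    refine tendsto_const_nhds.add (ENNReal.Tendsto.const_mul (ENNReal.tendsto_ofReal
      (((tendsto_pow_atTop_nhds_zero_of_lt_one hθ0.le hθ1).const_mul A).const_mul _)) (Or.inr ?_))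
    exact ENNReal.rpow_ne_top_of_nonneg (by positivity) (measure_ne_top μ _)
  have := ge_of_tendsto' hlim hbound
  simpa using this

end Transfer

/-- **L⁴ Strichartz estimate in adapted `V^p` spaces** (Corollary 5.4 (ii)).
For every `T > 0` and every `1 ≤ p < 4` there exists `C(T,p) > 0` such that for every
`N ≥ 1`, every sign `σ ∈ {+1, -1}` and every frequency-localized space-time function `u_N`
at scale `N` whose modulated coefficient curve `t ↦ (e^{-iσt⟨n⟩} c_n(t))_n ∈ ℓ²(S_N)` is
right-continuous, tends to `0` as `t → -∞`, and has finite `V^p`-norm, one has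
`‖u_N‖_{L⁴([0,T]×T³)} ≤ C(T,p) N^{1/2} ‖u_N‖_{V^p_σ}`. -/
theorem L4_strichartz_adapted_Vp (T : ℝ) (hT : 0 < T) (p : ℝ) (hp1 : 1 ≤ p) (hp4 : p < 4) :
    ∃ C > (0:ℝ), ∀ N : ℝ, 1 ≤ N → ∀ σ : ℝ, (σ = 1 ∨ σ = -1) →
      ∀ c : (Fin 3 → ℤ) → ℝ → ℂ, (∀ n, Measurable (c n)) →
      (∀ t : ℝ, ContinuousWithinAt (modCurve (annulus N) σ c) (Set.Ici t) t) →
      Tendsto (modCurve (annulus N) σ c) atBot (nhds 0) →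
      VpNorm p (modCurve (annulus N) σ c) ≠ ⊤ →
      eLpNorm (fun q : ℝ × (Fin 3 → ℝ) => freqLocFun (annulus N) c q.1 q.2)
          4 (volume.restrict (Set.Icc 0 T ×ˢ cube)) ≤
        ENNReal.ofReal (C * N ^ ((1:ℝ)/2)) * VpNorm p (modCurve (annulus N) σ c) := by
  have hp0 : 0 < p := by linarith
  set r : ℝ := (2 : ℝ) ^ ((1 : ℝ) / 4) * (2 : ℝ) ^ (-(1 / p)) with hr
  have hr1 : r < 1 := by
    rw [hr, ← Real.rpow_add (by norm_num)]
    refine Real.rpow_lt_one_of_one_lt_of_neg (by norm_num) ?_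
    have := one_div_lt_one_div_of_lt hp0 hp4
    linarith
  have hr2 : 0 < (1 - r)⁻¹ := inv_pos.2 (by linarith)
  set κ : ℝ := strichartzConst T ^ ((1 : ℝ) / 4) with hκ
  have hκ0 : 0 ≤ κ := Real.rpow_nonneg (strichartzConst_nonneg T) _
  have hκ4 : κ ^ 4 = strichartzConst T := by
    rw [hκ, ← Real.rpow_natCast, ← Real.rpow_mul (strichartzConst_nonneg T)]
    norm_num
  refine ⟨4 * κ * (1 + (1 - r)⁻¹) + 1, by positivity, fun N hN σ hσ c hc _ _ hv => ?_⟩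
  have hσ2 : σ ^ 2 = 1 := by rcases hσ with rfl | rfl <;> norm_num
  have hN0 : 0 ≤ N := by linarith
  have hN4 : (N ^ ((1 : ℝ) / 2)) ^ 4 = N ^ 2 := by
    rw [← Real.rpow_natCast, ← Real.rpow_mul hN0, ← Real.rpow_natCast]
    norm_num
  have hfin : IsFiniteMeasure
      ((volume : Measure (ℝ × (Fin 3 → ℝ))).restrict (Set.Icc 0 T ×ˢ cube)) := by
    rw [Measure.volume_eq_prod, ← Measure.prod_restrict]
    infer_instance
  rw [← evolve_modCurve]
  refine (eLpNorm_evolve_le_VpNorm (Q := κ * N ^ ((1 : ℝ) / 2)) (fun a => ?_) (by positivity)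
    hp1 hr hr1 hv ?_).trans ?_
  · rw [mul_pow, hκ4, hN4]
    exact lintegral_freqLocFun_freeCoeff_le hN hσ2 a
  · rw [evolve_modCurve]
    exact (measurable_freqLocFun hc).aestronglyMeasurable
  · nth_rewrite 2 [← ENNReal.ofReal_toReal hv]
    rw [← ENNReal.ofReal_mul (by positivity)]
    refine ENNReal.ofReal_le_ofReal (mul_le_mul_of_nonneg_right ?_ ENNReal.toReal_nonneg)
    have : 0 ≤ N ^ ((1 : ℝ) / 2) := by positivity
    nlinarith
end

section
/- (Refined L⁴ estimate for ball-localized functions, Proposition 5.5 in dimension three.) For every T > 0 there exists a constant C_T > 0 such that for all M, N ≥ 1 with M ≤ N, every ξ₀ ∈ ℤ³ with N ≤ |ξ₀| < 2N, every sign σ ∈ {+1, −1}, and every space-time function u(t, x) = ∑_{n ∈ ℤ³, |n−ξ₀| ≤ M} c_n(t) e^{i n·x} with measurable coefficients c_n : ℝ → ℂ, one has ‖u‖_{L⁴([0,T] × T³)} ≤ C_T N^{1/4} M^{1/4} ‖u‖_{U⁴_σ}. -/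
open MeasureTheory Filter
open scoped ENNReal Classical

/-- The lattice ball `{n ∈ ℤ³ : |n - ξ₀| ≤ M}` of radius `M` centered at `ξ₀ ∈ ℤ³`,
as a finite set of lattice points. -/
noncomputable def latticeBall (ξ₀ : Fin 3 → ℤ) (M : ℝ) : Finset (Fin 3 → ℤ) :=
  (Finset.Icc (fun i => ξ₀ i - ⌈M⌉) fun i => ξ₀ i + ⌈M⌉).filter fun n =>
    normZ (n - ξ₀) ≤ M

/-- A finite set of integers of diameter at most `ℓ` has at most `ℓ + 1` elements. -/
lemma card_int_le_of_diam (F : Finset ℤ) (ℓ : ℝ) (hℓ : 0 ≤ ℓ)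
    (h : ∀ y ∈ F, ∀ y' ∈ F, (y : ℝ) - y' ≤ ℓ) : (F.card : ℝ) ≤ ℓ + 1 := by
  rcases F.eq_empty_or_nonempty with rfl | hF
  · simp; linarith
  · have hsub : F ⊆ Finset.Icc (F.min' hF) (F.max' hF) := fun y hy =>
      Finset.mem_Icc.2 ⟨F.min'_le y hy, F.le_max' y hy⟩
    have hc := Finset.card_le_card hsub
    rw [Int.card_Icc] at hc
    have hle : F.min' hF ≤ F.max' hF := F.min'_le _ (F.max'_mem hF)
    have h1 := h _ (F.max'_mem hF) _ (F.min'_mem hF)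
    have h2 : (F.card : ℤ) ≤ F.max' hF + 1 - F.min' hF := by omega
    have h3 : (F.card : ℝ) ≤ F.max' hF + 1 - F.min' hF := by exact_mod_cast h2
    linarith

lemma card_le_fiber_mul_image {α β : Type*} [DecidableEq β] (F : Finset α) (f : α → β)
    (a b : ℝ) (ha0 : 0 ≤ a)
    (hb : ((F.image f).card : ℝ) ≤ b)
    (ha : ∀ z, ((F.filter (fun x => f x = z)).card : ℝ) ≤ a) : (F.card : ℝ) ≤ a * b := by
  rw [Finset.card_eq_sum_card_image f F]
  push_cast
  calc _ ≤ ∑ _z ∈ F.image f, a := Finset.sum_le_sum fun z _ => ha z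
    _ = a * (F.image f).card := by rw [Finset.sum_const, nsmul_eq_mul, mul_comm]
    _ ≤ a * b := by gcongr

/-- Points of a fixed horizontal line in an elliptic annulus, away from the critical point. -/
lemma card_line_annulus (F : Finset (ℤ × ℤ)) (A B e z s I L : ℝ) (hA : 1 / 3 ≤ A)
    (hL : 1 ≤ L) (hI : L ≤ I) (hs : s = 1 ∨ s = -1) (hz : ∀ p ∈ F, (p.2 : ℝ) = z)
    (hpos : ∀ p ∈ F, 0 ≤ s * (A * p.1 + B * p.2 + e))
    (hlow : ∀ p ∈ F, I / 8 ≤ (A * p.1 + B * p.2 + e) ^ 2)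
    (J : ℝ) (hJ : ∀ p ∈ F, J ≤ (A * p.1 + B * p.2 + e) ^ 2 ∧
      (A * p.1 + B * p.2 + e) ^ 2 ≤ J + L) :
    (F.card : ℝ) ≤ 6 * L / √I + 1 := by
  have hinj : Set.InjOn Prod.fst (F : Set (ℤ × ℤ)) := by
    intro p hp q hq hpq
    refine Prod.ext hpq ?_
    have := (hz p hp).trans (hz q hq).symm
    exact_mod_cast this
  have hI0 : 0 < I := by linarith
  have hsq : 0 < √I := Real.sqrt_pos.2 hI0
  have hss : √I ^ 2 = I := Real.sq_sqrt hI0.le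
  rw [← Finset.card_image_of_injOn hinj]
  refine card_int_le_of_diam _ _ (by positivity) ?_
  intro y hy y' hy'
  obtain ⟨p, hp, rfl⟩ := Finset.mem_image.1 hy
  obtain ⟨q, hq, rfl⟩ := Finset.mem_image.1 hy'
  have key : ∀ p ∈ F, √I / 4 ≤ s * (A * p.1 + B * p.2 + e) := by
    intro p hp
    apply le_of_sq_le_sq _ (hpos p hp)
    have : s ^ 2 = 1 := by rcases hs with rfl | rfl <;> norm_num
    rw [mul_pow, this, div_pow, hss]
    linarith [hlow p hp]
  have hp1 := key p hp
  have hq1 := key q hq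
  have hd : |(A * p.1 + B * p.2 + e) ^ 2 - (A * q.1 + B * q.2 + e) ^ 2| ≤ L := by
    rw [abs_le]; constructor <;> linarith [(hJ p hp).1, (hJ p hp).2, (hJ q hq).1, (hJ q hq).2]
  have hfac : (A * p.1 + B * p.2 + e) ^ 2 - (A * q.1 + B * q.2 + e) ^ 2
      = A * (p.1 - q.1) * (s * (s * (A * p.1 + B * p.2 + e) + s * (A * q.1 + B * q.2 + e))) := by
    have : s * s = 1 := by rcases hs with rfl | rfl <;> norm_num
    rw [← mul_add, ← mul_assoc s s, this, hz p hp, hz q hq]; ring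
  rw [hfac, abs_mul, abs_mul, abs_mul] at hd
  have hs1 : |s| = 1 := by rcases hs with rfl | rfl <;> norm_num
  rw [hs1, one_mul, abs_of_pos (by linarith : 0 < A)] at hd
  have h5 : √I / 2 ≤ |s * (A * p.1 + B * p.2 + e) + s * (A * q.1 + B * q.2 + e)| :=
    le_trans (by linarith) (le_abs_self _)
  refine (le_abs_self _).trans ?_
  rw [le_div_iff₀ hsq]
  have h6 : (1 / 3) * |(p.1 : ℝ) - q.1| * (√I / 2) ≤ L := le_trans (by gcongr) hd
  linarith

/-- Half of the lattice points of an elliptic annulus: those where the first component of the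
gradient is large. -/
lemma card_half_annulus (F : Finset (ℤ × ℤ)) (A B e D z₀ I L : ℝ) (hA : 1 / 3 ≤ A) (hA1 : A ≤ 1)
    (hD : 1 / 3 ≤ D) (hL : 1 ≤ L) (hI : L ≤ I)
    (h : ∀ p ∈ F, A * I ≤ (A * p.1 + B * p.2 + e) ^ 2 + D * (p.2 - z₀) ^ 2 ∧
      (A * p.1 + B * p.2 + e) ^ 2 + D * (p.2 - z₀) ^ 2 ≤ A * (I + L) ∧
      I / 8 ≤ (A * p.1 + B * p.2 + e) ^ 2) :
    (F.card : ℝ) ≤ 72 * L + 12 * √I := by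
  have hI0 : 0 < I := by linarith
  have hsq : 0 < √I := Real.sqrt_pos.2 hI0
  have hss : √I ^ 2 = I := Real.sq_sqrt hI0.le
  have hsq1 : 1 ≤ √I := Real.one_le_sqrt.2 (by linarith)
  have him : ((F.image Prod.snd).card : ℝ) ≤ 6 * √I := by
    have hb : ∀ p ∈ F, |(p.2 : ℝ) - z₀| ≤ 5 / 2 * √I := by
      intro p hp
      apply abs_le_of_sq_le_sq _ (by positivity)
      obtain ⟨-, h2, -⟩ := h p hp
      nlinarith [sq_nonneg (A * p.1 + B * p.2 + e), sq_nonneg ((p.2 : ℝ) - z₀)]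
    have := card_int_le_of_diam (F.image Prod.snd) (5 * √I) (by positivity) (by
      intro y hy y' hy'
      obtain ⟨p, hp, rfl⟩ := Finset.mem_image.1 hy
      obtain ⟨q, hq, rfl⟩ := Finset.mem_image.1 hy'
      linarith [(abs_le.1 (hb p hp)).2, (abs_le.1 (hb q hq)).1])
    linarith
  have hfib : ∀ z, ((F.filter (fun p => p.2 = z)).card : ℝ) ≤ 2 * (6 * L / √I + 1) := by
    intro z
    rw [← Finset.card_filter_add_card_filter_not (fun p : ℤ × ℤ => 0 ≤ A * p.1 + B * p.2 + e)]
    push_cast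
    have aux : ∀ G : Finset (ℤ × ℤ), (∀ p ∈ G, p ∈ F ∧ p.2 = z) → ∀ s : ℝ, (s = 1 ∨ s = -1) →
        (∀ p ∈ G, 0 ≤ s * (A * p.1 + B * p.2 + e)) → (G.card : ℝ) ≤ 6 * L / √I + 1 := by
      intro G hG s hs hpos
      refine card_line_annulus G A B e z s I L hA hL hI hs (fun p hp => by rw [(hG p hp).2])
        hpos (fun p hp => (h p (hG p hp).1).2.2) (A * I - D * (z - z₀) ^ 2) (fun p hp => ?_)
      have hp' := h p (hG p hp).1
      have hz : (p.2 : ℝ) = z := by rw [(hG p hp).2]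
      rw [hz] at hp' ⊢
      constructor
      · linarith [hp'.1]
      · nlinarith [hp'.2.1]
    have h1 := aux ((F.filter (fun p => p.2 = z)).filter
        (fun p : ℤ × ℤ => 0 ≤ A * p.1 + B * p.2 + e)) (fun p hp => by
          simpa using (Finset.mem_filter.1 hp).1) 1 (Or.inl rfl) (fun p hp => by
          simpa using (Finset.mem_filter.1 hp).2)
    have h2 := aux ((F.filter (fun p => p.2 = z)).filter
        (fun p : ℤ × ℤ => ¬ 0 ≤ A * p.1 + B * p.2 + e)) (fun p hp => by
          simpa using (Finset.mem_filter.1 hp).1) (-1) (Or.inr rfl) (fun p hp => by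
          have := (Finset.mem_filter.1 hp).2
          linarith)
    linarith
  refine (card_le_fiber_mul_image F Prod.snd (2 * (6 * L / √I + 1)) _
    (by positivity) him hfib).trans (le_of_eq ?_)
  field_simp
  ring

lemma quadratic_form_lt (A A' w₂ w₃ U V I : ℝ) (hA : A ≤ 1) (hA' : A' ≤ 1)
    (hw : w₂ ^ 2 + w₃ ^ 2 ≤ 2 / 3) (hU : U ^ 2 < I / 8) (hV : V ^ 2 < I / 8) :
    A' * U ^ 2 - 2 * (-(w₂ * w₃)) * U * V + A * V ^ 2 < 1 / 3 * I := by
  have hB : |w₂ * w₃| ≤ 1 / 3 := by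
    rw [abs_le]; constructor <;> nlinarith [sq_nonneg (w₂ - w₃), sq_nonneg (w₂ + w₃)]
  have hUV : |2 * (U * V)| ≤ U ^ 2 + V ^ 2 := by
    rw [abs_le]; constructor <;> nlinarith [sq_nonneg (U - V), sq_nonneg (U + V)]
  have h5 : (w₂ * w₃) * (2 * (U * V)) ≤ 1 / 3 * (U ^ 2 + V ^ 2) := by
    refine (le_abs_self _).trans ?_
    rw [abs_mul]
    gcongr
  have h7 : A' * U ^ 2 ≤ 1 * U ^ 2 := by gcongr
  have h8 : A * V ^ 2 ≤ 1 * V ^ 2 := by gcongr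
  linarith

/-- Lattice points in the annular region between two level sets of the elliptic quadratic
polynomial `y² + z² - (w₂ y + w₃ z + c)²`. -/
lemma card_elliptic_annulus (F : Finset (ℤ × ℤ)) (w₂ w₃ c I₀ L R : ℝ)
    (hw : w₂ ^ 2 + w₃ ^ 2 ≤ 2 / 3) (hL : 1 ≤ L) (hR : 0 ≤ R) (hc : c ^ 2 ≤ R ^ 2)
    (h : ∀ p ∈ F, I₀ ≤ (p.1 : ℝ) ^ 2 + (p.2 : ℝ) ^ 2 - (w₂ * p.1 + w₃ * p.2 + c) ^ 2 ∧
      (p.1 : ℝ) ^ 2 + (p.2 : ℝ) ^ 2 - (w₂ * p.1 + w₃ * p.2 + c) ^ 2 ≤ I₀ + L ∧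
      (p.1 : ℝ) ^ 2 + (p.2 : ℝ) ^ 2 ≤ R ^ 2) :
    (F.card : ℝ) ≤ 200 * (L + R) := by
  set D : ℝ := 1 - w₂ ^ 2 - w₃ ^ 2 with hDdef
  have hD : 1 / 3 ≤ D := by linarith
  have hD0 : D ≠ 0 := by linarith
  have hD1 : 0 < D := by linarith
  set I : ℝ := I₀ + c ^ 2 / D with hIdef
  set P : ℤ × ℤ → ℝ := fun p => (p.1 : ℝ) ^ 2 + (p.2 : ℝ) ^ 2 - (w₂ * p.1 + w₃ * p.2 + c) ^ 2
    + c ^ 2 / D with hPdef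
  have hP : ∀ p ∈ F, I ≤ P p ∧ P p ≤ I + L := by
    intro p hp
    obtain ⟨h1, h2, h3⟩ := h p hp
    simp only [hPdef, hIdef]
    constructor <;> linarith
  set A : ℝ := 1 - w₂ ^ 2 with hAdef
  set A' : ℝ := 1 - w₃ ^ 2 with hA'def
  set B : ℝ := -(w₂ * w₃) with hBdef
  have hA : 1 / 3 ≤ A := by nlinarith [sq_nonneg w₃]
  have hA' : 1 / 3 ≤ A' := by nlinarith [sq_nonneg w₂]
  have hA1 : A ≤ 1 := by nlinarith [sq_nonneg w₂]
  have hA'1 : A' ≤ 1 := by nlinarith [sq_nonneg w₃]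
  have id1 : ∀ p : ℤ × ℤ, (A * p.1 + B * p.2 + (-(w₂ * c))) ^ 2 + D * (p.2 - c * w₃ / D) ^ 2
      = A * P p := by
    intro p
    have e1 : D * (p.2 - c * w₃ / D) ^ 2
      = D * (p.2 : ℝ) ^ 2 - 2 * p.2 * c * w₃ + c ^ 2 / D * w₃ ^ 2 := by field_simp; ring
    have e2 : A * (c ^ 2 / D) = c ^ 2 + c ^ 2 / D * w₃ ^ 2 := by
      field_simp; rw [hDdef, hAdef]; ring
    simp only [hPdef]
    rw [mul_add, e2, e1, hDdef, hAdef, hBdef]; ring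
  have id2 : ∀ p : ℤ × ℤ, (A' * p.2 + B * p.1 + (-(w₃ * c))) ^ 2 + D * (p.1 - c * w₂ / D) ^ 2
      = A' * P p := by
    intro p
    have e1 : D * (p.1 - c * w₂ / D) ^ 2
      = D * (p.1 : ℝ) ^ 2 - 2 * p.1 * c * w₂ + c ^ 2 / D * w₂ ^ 2 := by field_simp; ring
    have e2 : A' * (c ^ 2 / D) = c ^ 2 + c ^ 2 / D * w₂ ^ 2 := by
      field_simp; rw [hDdef, hA'def]; ring
    simp only [hPdef]
    rw [mul_add, e2, e1, hDdef, hA'def, hBdef]; ring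
  rcases F.eq_empty_or_nonempty with rfl | ⟨p₀, hp₀⟩
  · simp; linarith
  by_cases hIL : L ≤ I
  · have hI0 : 0 ≤ I := by linarith
    have hIR : √I ≤ 2 * R := by
      rw [Real.sqrt_le_left (by positivity)]
      have h1 := (hP p₀ hp₀).1
      have h2 := (h p₀ hp₀).2.2
      have h3 : c ^ 2 / D ≤ 3 * R ^ 2 := by
        rw [div_le_iff₀ hD1]; nlinarith [sq_nonneg c, sq_nonneg R]
      simp only [hPdef] at h1
      nlinarith [sq_nonneg (w₂ * p₀.1 + w₃ * p₀.2 + c)]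
    have id3 : ∀ p : ℤ × ℤ, D * P p = A' * (A * p.1 + B * p.2 + (-(w₂ * c))) ^ 2
        - 2 * B * (A * p.1 + B * p.2 + (-(w₂ * c))) * (A' * p.2 + B * p.1 + (-(w₃ * c)))
        + A * (A' * p.2 + B * p.1 + (-(w₃ * c))) ^ 2 := by
      intro p
      have e2 : D * (c ^ 2 / D) = c ^ 2 := by field_simp
      simp only [hPdef]
      rw [mul_add, e2, hDdef, hAdef, hA'def, hBdef]; ring
    rw [← Finset.card_filter_add_card_filter_not
      (fun p : ℤ × ℤ => I / 8 ≤ (A * p.1 + B * p.2 + (-(w₂ * c))) ^ 2)]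
    have h1 := card_half_annulus (F.filter
      (fun p : ℤ × ℤ => I / 8 ≤ (A * p.1 + B * p.2 + (-(w₂ * c))) ^ 2)) A B (-(w₂ * c)) D
      (c * w₃ / D) I L hA hA1 hD hL hIL (by
        intro p hp
        obtain ⟨hp1, hp2⟩ := Finset.mem_filter.1 hp
        rw [id1]
        refine ⟨?_, ?_, hp2⟩
        · have := (hP p hp1).1; gcongr
        · have := (hP p hp1).2; gcongr)
    have h2 := card_half_annulus ((F.filter
      (fun p : ℤ × ℤ => ¬ I / 8 ≤ (A * p.1 + B * p.2 + (-(w₂ * c))) ^ 2)).image Prod.swap)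
      A' B (-(w₃ * c)) D (c * w₂ / D) I L hA' hA'1 hD hL hIL (by
        intro q hq
        obtain ⟨p, hp, rfl⟩ := Finset.mem_image.1 hq
        obtain ⟨hp1, hp2⟩ := Finset.mem_filter.1 hp
        simp only [Prod.fst_swap, Prod.snd_swap]
        rw [id2]
        refine ⟨?_, ?_, ?_⟩
        · have := (hP p hp1).1; gcongr
        · have := (hP p hp1).2; gcongr
        · by_contra hcon
          push Not at hp2 hcon
          have h3 := id3 p
          have h6 : 1 / 3 * I ≤ D * P p := by
            have := (hP p hp1).1
            gcongr
          have := quadratic_form_lt A A' w₂ w₃ _ _ I hA1 hA'1 hw hp2 hcon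
          rw [hBdef] at h3 hcon hp2
          linarith)
    rw [Finset.card_image_of_injective _ Prod.swap_injective] at h2
    push_cast
    linarith
  · push Not at hIL
    have hL0 : 0 ≤ L := by linarith
    have hss : √L ^ 2 = L := Real.sq_sqrt hL0
    have hs1 : 1 ≤ √L := Real.one_le_sqrt.2 hL
    have hP0 : ∀ p ∈ F, P p ≤ 2 * L := fun p hp => by linarith [(hP p hp).2]
    have hy : ((F.image Prod.fst).card : ℝ) ≤ 6 * √L := by
      have hb : ∀ p ∈ F, |(p.1 : ℝ) - c * w₂ / D| ≤ 5 / 2 * √L := by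
        intro p hp
        apply abs_le_of_sq_le_sq _ (by positivity)
        have h1 := id2 p
        have h2 := hP0 p hp
        nlinarith [sq_nonneg (A' * p.2 + B * p.1 + (-(w₃ * c))),
          sq_nonneg ((p.1 : ℝ) - c * w₂ / D)]
      have := card_int_le_of_diam (F.image Prod.fst) (5 * √L) (by positivity) (by
        intro y hy y' hy'
        obtain ⟨p, hp, rfl⟩ := Finset.mem_image.1 hy
        obtain ⟨q, hq, rfl⟩ := Finset.mem_image.1 hy'
        linarith [(abs_le.1 (hb p hp)).2, (abs_le.1 (hb q hq)).1])
      linarith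
    have hz : ((F.image Prod.snd).card : ℝ) ≤ 6 * √L := by
      have hb : ∀ p ∈ F, |(p.2 : ℝ) - c * w₃ / D| ≤ 5 / 2 * √L := by
        intro p hp
        apply abs_le_of_sq_le_sq _ (by positivity)
        have h1 := id1 p
        have h2 := hP0 p hp
        nlinarith [sq_nonneg (A * p.1 + B * p.2 + (-(w₂ * c))),
          sq_nonneg ((p.2 : ℝ) - c * w₃ / D)]
      have := card_int_le_of_diam (F.image Prod.snd) (5 * √L) (by positivity) (by
        intro y hy y' hy'
        obtain ⟨p, hp, rfl⟩ := Finset.mem_image.1 hy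
        obtain ⟨q, hq, rfl⟩ := Finset.mem_image.1 hy'
        linarith [(abs_le.1 (hb p hp)).2, (abs_le.1 (hb q hq)).1])
      linarith
    have hsub : F ⊆ F.image Prod.fst ×ˢ F.image Prod.snd := Finset.subset_product
    have hcard := Finset.card_le_card hsub
    rw [Finset.card_product] at hcard
    have : (F.card : ℝ) ≤ (F.image Prod.fst).card * (F.image Prod.snd).card := by
      exact_mod_cast hcard
    have h2 : ((F.image Prod.fst).card : ℝ) * (F.image Prod.snd).card ≤ 6 * √L * (6 * √L) := by
      gcongr
    nlinarith

/-- Lattice points in space between two level sets of `|m|² - (v·m)²`, when the last two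
coordinates of `v` are not too large. -/
lemma card_quadratic_shell_aux (G : Finset (ℤ × ℤ × ℤ)) (v₁ v₂ v₃ I L R : ℝ)
    (hv₁ : v₁ ^ 2 ≤ 1) (hw : v₂ ^ 2 + v₃ ^ 2 ≤ 2 / 3) (hL : 1 ≤ L) (hR : 0 ≤ R)
    (h : ∀ m ∈ G, I ≤ (m.1 : ℝ) ^ 2 + (m.2.1 : ℝ) ^ 2 + (m.2.2 : ℝ) ^ 2
        - (v₁ * m.1 + v₂ * m.2.1 + v₃ * m.2.2) ^ 2 ∧
      (m.1 : ℝ) ^ 2 + (m.2.1 : ℝ) ^ 2 + (m.2.2 : ℝ) ^ 2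
        - (v₁ * m.1 + v₂ * m.2.1 + v₃ * m.2.2) ^ 2 ≤ I + L ∧
      (m.1 : ℝ) ^ 2 + (m.2.1 : ℝ) ^ 2 + (m.2.2 : ℝ) ^ 2 ≤ R ^ 2) :
    (G.card : ℝ) ≤ 200 * (L + R) * (2 * R + 1) := by
  refine card_le_fiber_mul_image G Prod.fst _ _ (by positivity) ?_ ?_
  · refine card_int_le_of_diam _ _ (by positivity) ?_
    have hb : ∀ m ∈ G, |(m.1 : ℝ)| ≤ R := by
      intro m hm
      apply abs_le_of_sq_le_sq _ hR
      nlinarith [(h m hm).2.2, sq_nonneg (m.2.1 : ℝ), sq_nonneg (m.2.2 : ℝ)]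
    intro y hy y' hy'
    obtain ⟨p, hp, rfl⟩ := Finset.mem_image.1 hy
    obtain ⟨q, hq, rfl⟩ := Finset.mem_image.1 hy'
    linarith [(abs_le.1 (hb p hp)).2, (abs_le.1 (hb q hq)).1]
  · intro x
    have hinj : Set.InjOn Prod.snd (G.filter (fun m => m.1 = x) : Set (ℤ × ℤ × ℤ)) := by
      intro p hp q hq hpq
      simp only [Finset.coe_filter, Set.mem_ofPred_eq] at hp hq
      exact Prod.ext (hp.2.trans hq.2.symm) hpq
    rw [← Finset.card_image_of_injOn hinj]
    rcases (G.filter (fun m => m.1 = x)).eq_empty_or_nonempty with he | ⟨m₀, hm₀⟩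
    · rw [he]; simp; positivity
    obtain ⟨hm₀, hx₀⟩ := Finset.mem_filter.1 hm₀
    have hxR : (x : ℝ) ^ 2 ≤ R ^ 2 := by
      have := (h m₀ hm₀).2.2
      rw [hx₀] at this
      nlinarith [sq_nonneg (m₀.2.1 : ℝ), sq_nonneg (m₀.2.2 : ℝ)]
    refine card_elliptic_annulus _ v₂ v₃ (v₁ * x) (I - x ^ 2) L R hw hL hR ?_ ?_
    · rw [mul_pow]
      nlinarith [sq_nonneg (x : ℝ)]
    · intro p hp
      obtain ⟨m, hm, rfl⟩ := Finset.mem_image.1 hp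
      obtain ⟨hmG, rfl⟩ := Finset.mem_filter.1 hm
      obtain ⟨h1, h2, h3⟩ := h m hmG
      refine ⟨?_, ?_, ?_⟩ <;> nlinarith

/-- Lattice points in space between two level sets of `|m|² - (v·m)²`, where `|v| ≤ 1`. -/
lemma card_quadratic_shell (G : Finset (Fin 3 → ℤ)) (v : Fin 3 → ℝ) (I L R : ℝ)
    (hv : ∑ i, v i ^ 2 ≤ 1) (hL : 1 ≤ L) (hR : 0 ≤ R)
    (h : ∀ m ∈ G, I ≤ ∑ i, (m i : ℝ) ^ 2 - (∑ i, v i * m i) ^ 2 ∧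
      ∑ i, (m i : ℝ) ^ 2 - (∑ i, v i * m i) ^ 2 ≤ I + L ∧ ∑ i, (m i : ℝ) ^ 2 ≤ R ^ 2) :
    (G.card : ℝ) ≤ 200 * (L + R) * (2 * R + 1) := by
  simp only [Fin.sum_univ_three] at hv h
  have aux : ∀ a b c : Fin 3, (∀ i, i = a ∨ i = b ∨ i = c) →
      (∀ w : Fin 3 → ℝ, w 0 + w 1 + w 2 = w a + w b + w c) →
      v b ^ 2 + v c ^ 2 ≤ 2 / 3 → (G.card : ℝ) ≤ 200 * (L + R) * (2 * R + 1) := by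
    intro a b c hex hsum hbc
    have hinj : Function.Injective (fun m : Fin 3 → ℤ => (m a, m b, m c)) := by
      intro m m' hm
      simp only [Prod.mk.injEq] at hm
      ext i
      rcases hex i with rfl | rfl | rfl
      exacts [hm.1, hm.2.1, hm.2.2]
    rw [← Finset.card_image_of_injective G hinj]
    refine card_quadratic_shell_aux _ (v a) (v b) (v c) I L R ?_ hbc hL hR ?_
    · have := hsum (fun i => v i ^ 2)
      nlinarith [sq_nonneg (v b), sq_nonneg (v c)]
    · intro p hp
      obtain ⟨m, hm, rfl⟩ := Finset.mem_image.1 hp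
      have h1 := h m hm
      have h2 := hsum (fun i => (m i : ℝ) ^ 2)
      have h3 := hsum (fun i => v i * m i)
      rw [h2, h3] at h1
      exact h1
  by_cases h0 : v 1 ^ 2 + v 2 ^ 2 ≤ 2 / 3
  · exact aux 0 1 2 (by decide) (fun w => rfl) h0
  by_cases h1 : v 0 ^ 2 + v 2 ^ 2 ≤ 2 / 3
  · exact aux 1 0 2 (by decide) (fun w => by ring) h1
  · exact aux 2 0 1 (by decide) (fun w => by ring) (by linarith)

lemma normZ_sq (n : Fin 3 → ℤ) : normZ n ^ 2 = ∑ i, (n i : ℝ) ^ 2 :=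
  Real.sq_sqrt (by positivity)

lemma jbZ_sq (n : Fin 3 → ℤ) : jbZ n ^ 2 = 1 + ∑ i, (n i : ℝ) ^ 2 :=
  Real.sq_sqrt (by positivity)

lemma one_le_jbZ (n : Fin 3 → ℤ) : 1 ≤ jbZ n :=
  Real.one_le_sqrt.2 (by linarith [show 0 ≤ ∑ i, (n i : ℝ) ^ 2 by positivity])

lemma normZ_eq_norm (n : Fin 3 → ℤ) :
    normZ n = ‖(WithLp.toLp 2 (fun i => (n i : ℝ)) : EuclideanSpace ℝ (Fin 3))‖ := by
  simp [normZ, EuclideanSpace.norm_eq]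

lemma normZ_add_le (m n : Fin 3 → ℤ) : normZ (m + n) ≤ normZ m + normZ n := by
  simp only [normZ_eq_norm]
  refine le_trans (le_of_eq ?_) (norm_add_le _ _)
  congr 1
  ext i
  simp

lemma normZ_neg (n : Fin 3 → ℤ) : normZ (-n) = normZ n := by simp [normZ]

lemma jbZ_le (n : Fin 3 → ℤ) : jbZ n ≤ 1 + normZ n := by
  apply Real.sqrt_le_iff.2
  have h0 : 0 ≤ normZ n := Real.sqrt_nonneg _
  refine ⟨by linarith, ?_⟩
  rw [← normZ_sq]; nlinarith

lemma normZ_lt_jbZ (n : Fin 3 → ℤ) : normZ n < jbZ n :=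
  Real.sqrt_lt_sqrt (by positivity) (by linarith)

/-- If `⟨n⟩ + ⟨n'⟩ = s` then `m = n - n'` lies on a quadric depending on `n + n'` and `s`. -/
lemma jbZ_quadric (n n' : Fin 3 → ℤ) :
    (∑ i, ((n i : ℝ) - n' i) * ((n i : ℝ) + n' i) = (jbZ n - jbZ n') * (jbZ n + jbZ n')) ∧
    ∑ i, ((n i : ℝ) - n' i) ^ 2 - (jbZ n - jbZ n') ^ 2
      = (jbZ n + jbZ n') ^ 2 - ∑ i, ((n i : ℝ) + n' i) ^ 2 - 4 := by
  have h1 := jbZ_sq n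
  have h2 := jbZ_sq n'
  simp only [Fin.sum_univ_three] at h1 h2 ⊢
  constructor <;> nlinarith

/-- The number of pairs of frequencies in a ball with prescribed sum and with the sum of
their brackets in a unit interval. -/
lemma card_resonant_pairs (E : Finset ((Fin 3 → ℤ) × (Fin 3 → ℤ))) (k ξ₀ : Fin 3 → ℤ)
    (M N τ : ℝ) (hM : 1 ≤ M) (hMN : M ≤ N) (hξ : normZ ξ₀ < 2 * N)
    (h : ∀ q ∈ E, q.1 + q.2 = k ∧ normZ (q.1 - ξ₀) ≤ M ∧ normZ (q.2 - ξ₀) ≤ M ∧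
      τ ≤ jbZ q.1 + jbZ q.2 ∧ jbZ q.1 + jbZ q.2 < τ + 1) :
    (E.card : ℝ) ≤ 114000 * N * M := by
  have hN : 1 ≤ N := hM.trans hMN
  rcases E.eq_empty_or_nonempty with rfl | ⟨q₀, hq₀⟩
  · simp only [Finset.card_empty, Nat.cast_zero]; positivity
  set t : ℝ := jbZ q₀.1 + jbZ q₀.2 with ht
  have ht2 : 2 ≤ t := by linarith [one_le_jbZ q₀.1, one_le_jbZ q₀.2]
  have ht0 : t ≠ 0 := by linarith
  have hbd : ∀ n : Fin 3 → ℤ, normZ (n - ξ₀) ≤ M → jbZ n ≤ 4 * N := by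
    intro n hn
    have h1 := normZ_add_le (n - ξ₀) ξ₀
    rw [sub_add_cancel] at h1
    linarith [jbZ_le n]
  have ht8 : t ≤ 8 * N := by linarith [hbd _ (h q₀ hq₀).2.1, hbd _ (h q₀ hq₀).2.2.1]
  have hinj : Set.InjOn (fun q : (Fin 3 → ℤ) × (Fin 3 → ℤ) => q.1 - q.2) E := by
    intro p hp q hq hpq
    have h1 := (h p hp).1.trans (h q hq).1.symm
    simp only at hpq
    have h2 : ∀ i, p.1 i = q.1 i ∧ p.2 i = q.2 i := by
      intro i
      have h3 := congrFun hpq i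
      have h4 := congrFun h1 i
      simp only [Pi.sub_apply, Pi.add_apply] at h3 h4
      omega
    exact Prod.ext (funext fun i => (h2 i).1) (funext fun i => (h2 i).2)
  rw [← Finset.card_image_of_injOn hinj]
  have hk : ∑ i, (k i : ℝ) ^ 2 ≤ t ^ 2 := by
    rw [← normZ_sq, ← (h q₀ hq₀).1]
    have h0 : 0 ≤ normZ (q₀.1 + q₀.2) := Real.sqrt_nonneg _
    have h1 := normZ_add_le q₀.1 q₀.2
    have h2 : normZ (q₀.1 + q₀.2) ≤ t := by linarith [normZ_lt_jbZ q₀.1, normZ_lt_jbZ q₀.2]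
    gcongr
  have hmain := card_quadratic_shell (E.image (fun q => q.1 - q.2)) (fun i => k i / t)
    (t ^ 2 - ∑ i, (k i : ℝ) ^ 2 - 4 - 56 * N) (112 * N) (2 * M) ?_ (by linarith) (by linarith) ?_
  · refine hmain.trans ?_
    have h1 : 112 * N + 2 * M ≤ 114 * N := by linarith
    have h2 : 2 * (2 * M) + 1 ≤ 5 * M := by linarith
    calc _ ≤ 200 * (114 * N) * (5 * M) := by gcongr
      _ = _ := by ring
  · simp only [div_pow]
    rw [← Finset.sum_div, div_le_one (by positivity)]
    exact hk
  · intro m hm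
    obtain ⟨q, hq, rfl⟩ := Finset.mem_image.1 hm
    obtain ⟨h1, h2, h3, h4, h5⟩ := h q hq
    obtain ⟨-, -, -, h4', h5'⟩ := h q₀ hq₀
    have hkr : ∀ i, (k i : ℝ) = q.1 i + q.2 i := by
      intro i; rw [← h1]; simp
    have hlin : ∑ i, (k i / t : ℝ) * ((q.1 - q.2) i : ℤ)
        = (jbZ q.1 - jbZ q.2) * (jbZ q.1 + jbZ q.2) / t := by
      rw [← (jbZ_quadric q.1 q.2).1, Finset.sum_div]
      refine Finset.sum_congr rfl fun i _ => ?_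
      rw [hkr i]
      push_cast [Pi.sub_apply]
      ring
    have hquad := (jbZ_quadric q.1 q.2).2
    have hsq : ∑ i, ((q.1 - q.2) i : ℝ) ^ 2 = ∑ i, ((q.1 i : ℝ) - q.2 i) ^ 2 := by
      refine Finset.sum_congr rfl fun i _ => ?_
      push_cast [Pi.sub_apply]
      ring
    have hksum : ∑ i, (k i : ℝ) ^ 2 = ∑ i, ((q.1 i : ℝ) + q.2 i) ^ 2 :=
      Finset.sum_congr rfl fun i _ => by rw [hkr i]
    have hR : ∑ i, ((q.1 - q.2) i : ℝ) ^ 2 ≤ (2 * M) ^ 2 := by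
      rw [← normZ_sq]
      have e : q.1 - q.2 = (q.1 - ξ₀) + -(q.2 - ξ₀) := by abel
      have h6 : normZ (q.1 - q.2) ≤ 2 * M := by
        rw [e]
        refine (normZ_add_le _ _).trans ?_
        rw [normZ_neg]; linarith
      have h0 : 0 ≤ normZ (q.1 - q.2) := Real.sqrt_nonneg _
      gcongr
    rw [hlin, hsq, hksum]
    set s : ℝ := jbZ q.1 + jbZ q.2 with hs
    set d : ℝ := jbZ q.1 - jbZ q.2 with hd
    have hds : d ^ 2 ≤ s ^ 2 := by
      have := one_le_jbZ q.1
      have := one_le_jbZ q.2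
      nlinarith
    have hst : |s - t| ≤ 1 := by rw [abs_le]; constructor <;> linarith
    have hs2 : s ≤ 3 / 2 * t := by linarith [(abs_le.1 hst).2]
    have hs0 : 0 ≤ s := by linarith [(abs_le.1 hst).1]
    have hdt : d ^ 2 / t ^ 2 ≤ 9 / 4 := by
      rw [div_le_iff₀ (by positivity)]
      nlinarith
    have hstsq : |s ^ 2 - t ^ 2| ≤ 17 * N := by
      rw [show s ^ 2 - t ^ 2 = (s - t) * (s + t) by ring, abs_mul]
      have h7 : |s + t| ≤ 17 * N := by
        rw [abs_of_nonneg (by linarith)]; linarith [(abs_le.1 hst).2]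
      calc _ ≤ 1 * (17 * N) := by gcongr
        _ = _ := one_mul _
    have hdiff : |(s ^ 2 - t ^ 2) * (1 - d ^ 2 / t ^ 2)| ≤ 56 * N := by
      rw [abs_mul]
      have h8 : |1 - d ^ 2 / t ^ 2| ≤ 13 / 4 := by
        have : 0 ≤ d ^ 2 / t ^ 2 := by positivity
        rw [abs_le]; constructor <;> linarith
      calc _ ≤ 17 * N * (13 / 4) := by gcongr
        _ ≤ _ := by linarith
    have hexp : ∑ i, ((q.1 i : ℝ) - q.2 i) ^ 2 - (d * s / t) ^ 2
        = t ^ 2 - ∑ i, ((q.1 i : ℝ) + q.2 i) ^ 2 - 4 + (s ^ 2 - t ^ 2) * (1 - d ^ 2 / t ^ 2) := by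
      have e : (d * s / t) ^ 2 = d ^ 2 + (s ^ 2 - t ^ 2) * (d ^ 2 / t ^ 2) := by
        field_simp; ring
      rw [e]; linarith
    rw [hexp]
    refine ⟨?_, ?_, ?_⟩
    · linarith [(abs_le.1 hdiff).1]
    · linarith [(abs_le.1 hdiff).2]
    · rw [← hsq]; exact hR

lemma integral_exp_int_mul (k : ℤ) :
    ∫ x in Set.Ico (0 : ℝ) (2 * Real.pi), Complex.exp (Complex.I * ((k * x : ℝ) : ℂ))
      = if k = 0 then ((2 * Real.pi : ℝ) : ℂ) else 0 := by
  have h2pi : (0 : ℝ) ≤ 2 * Real.pi := by positivity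
  rw [integral_Ico_eq_integral_Ioc, ← intervalIntegral.integral_of_le h2pi]
  split_ifs with hk
  · simp [hk]
  · have hc : Complex.I * (k : ℂ) ≠ 0 :=
      mul_ne_zero Complex.I_ne_zero (Int.cast_ne_zero.2 hk)
    have e : ∀ x : ℝ, Complex.I * ((k * x : ℝ) : ℂ) = Complex.I * (k : ℂ) * x := by
      intro x; push_cast; ring
    simp_rw [e]
    rw [integral_exp_mul_complex hc]
    have e2 : Complex.I * (k : ℂ) * ((2 * Real.pi : ℝ) : ℂ) = k * (2 * Real.pi * Complex.I) := by
      push_cast; ring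
    rw [e2, Complex.exp_int_mul_two_pi_mul_I]
    simp

lemma volume_restrict_cube : (volume : Measure (Fin 3 → ℝ)).restrict cube
    = Measure.pi fun _ => (volume : Measure ℝ).restrict (Set.Ico 0 (2 * Real.pi)) := by
  rw [volume_pi, cube, Measure.restrict_pi_pi]

lemma exp_dotZ (k : Fin 3 → ℤ) (x : Fin 3 → ℝ) : Complex.exp (Complex.I * ((dotZ k x : ℝ) : ℂ))
    = ∏ i, Complex.exp (Complex.I * ((k i * x i : ℝ) : ℂ)) := by
  rw [← Complex.exp_sum, ← Finset.mul_sum, dotZ]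
  push_cast
  rfl

/-- Orthogonality of the characters of the torus. -/
lemma integral_cube_exp (k : Fin 3 → ℤ) :
    ∫ x in cube, Complex.exp (Complex.I * ((dotZ k x : ℝ) : ℂ))
      = if k = 0 then (((2 * Real.pi) ^ 3 : ℝ) : ℂ) else 0 := by
  simp_rw [exp_dotZ]
  rw [volume_restrict_cube, integral_fintype_prod_eq_prod
    (fun i (y : ℝ) => Complex.exp (Complex.I * ((k i * y : ℝ) : ℂ)))]
  simp_rw [integral_exp_int_mul]
  split_ifs with hk
  · simp [hk]
  · obtain ⟨i, hi⟩ := Function.ne_iff.1 hk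
    exact Finset.prod_eq_zero (Finset.mem_univ i) (if_neg hi)

lemma integrable_cube_exp (k : Fin 3 → ℤ) :
    Integrable (fun x => Complex.exp (Complex.I * ((dotZ k x : ℝ) : ℂ)))
      (volume.restrict cube) := by
  have : IsFiniteMeasure ((volume : Measure (Fin 3 → ℝ)).restrict cube) := by
    rw [volume_restrict_cube]; infer_instance
  refine Integrable.of_bound (C := 1) ?_ (ae_of_all _ fun x => ?_)
  · refine Continuous.aestronglyMeasurable ?_
    unfold dotZ
    fun_prop
  · rw [mul_comm, Complex.norm_exp_ofReal_mul_I]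

lemma integrableOn_exp_abs_Ioi (ω : ℝ) :
    IntegrableOn (fun t : ℝ => ((Real.exp (-|t|) : ℝ) : ℂ) *
      Complex.exp (Complex.I * ((ω * t : ℝ) : ℂ))) (Set.Ioi 0) ∧
    ∫ t in Set.Ioi (0 : ℝ), ((Real.exp (-|t|) : ℝ) : ℂ) *
      Complex.exp (Complex.I * ((ω * t : ℝ) : ℂ)) = 1 / (1 - Complex.I * ω) := by
  have hre : (-1 + Complex.I * (ω : ℂ)).re < 0 := by simp
  have e : Set.EqOn (fun t : ℝ => Complex.exp ((-1 + Complex.I * (ω : ℂ)) * t))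
      (fun t : ℝ => ((Real.exp (-|t|) : ℝ) : ℂ) * Complex.exp (Complex.I * ((ω * t : ℝ) : ℂ)))
      (Set.Ioi 0) := by
    intro t ht
    simp only
    rw [abs_of_pos ht, Complex.ofReal_exp, ← Complex.exp_add]
    congr 1; push_cast; ring
  refine ⟨(integrableOn_exp_mul_complex_Ioi hre 0).congr_fun e measurableSet_Ioi, ?_⟩
  rw [← setIntegral_congr_fun measurableSet_Ioi e, integral_exp_mul_complex_Ioi hre]
  rw [Complex.ofReal_zero, mul_zero, Complex.exp_zero, ← neg_div_neg_eq]
  congr 1 <;> ring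

lemma integrableOn_exp_abs_Iic (ω : ℝ) :
    IntegrableOn (fun t : ℝ => ((Real.exp (-|t|) : ℝ) : ℂ) *
      Complex.exp (Complex.I * ((ω * t : ℝ) : ℂ))) (Set.Iic 0) ∧
    ∫ t in Set.Iic (0 : ℝ), ((Real.exp (-|t|) : ℝ) : ℂ) *
      Complex.exp (Complex.I * ((ω * t : ℝ) : ℂ)) = 1 / (1 + Complex.I * ω) := by
  have hre : 0 < (1 + Complex.I * (ω : ℂ)).re := by simp
  have e : Set.EqOn (fun t : ℝ => Complex.exp ((1 + Complex.I * (ω : ℂ)) * t))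
      (fun t : ℝ => ((Real.exp (-|t|) : ℝ) : ℂ) * Complex.exp (Complex.I * ((ω * t : ℝ) : ℂ)))
      (Set.Iic 0) := by
    intro t ht
    simp only
    rw [abs_of_nonpos ht, Complex.ofReal_exp, ← Complex.exp_add]
    congr 1; push_cast; ring
  refine ⟨(integrableOn_exp_mul_complex_Iic hre 0).congr_fun e measurableSet_Iic, ?_⟩
  rw [← setIntegral_congr_fun measurableSet_Iic e, integral_exp_mul_complex_Iic hre]
  rw [Complex.ofReal_zero, mul_zero, Complex.exp_zero]

lemma integrable_exp_abs (ω : ℝ) : Integrable (fun t : ℝ => ((Real.exp (-|t|) : ℝ) : ℂ) *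
    Complex.exp (Complex.I * ((ω * t : ℝ) : ℂ))) := by
  rw [← integrableOn_univ, ← Set.Iic_union_Ioi (a := (0 : ℝ))]
  exact (integrableOn_exp_abs_Iic ω).1.union (integrableOn_exp_abs_Ioi ω).1

/-- The Fourier transform of `e^{-|t|}`. -/
lemma integral_exp_abs (ω : ℝ) : ∫ t : ℝ, ((Real.exp (-|t|) : ℝ) : ℂ) *
    Complex.exp (Complex.I * ((ω * t : ℝ) : ℂ)) = ((2 / (1 + ω ^ 2) : ℝ) : ℂ) := by
  rw [← setIntegral_univ, ← Set.Iic_union_Ioi (a := (0 : ℝ)),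
    setIntegral_union (Set.Iic_disjoint_Ioi le_rfl) measurableSet_Ioi
      (integrableOn_exp_abs_Iic ω).1 (integrableOn_exp_abs_Ioi ω).1,
    (integrableOn_exp_abs_Iic ω).2, (integrableOn_exp_abs_Ioi ω).2]
  have h1 : (1 + Complex.I * (ω : ℂ)) ≠ 0 := fun h => by
    simpa using congrArg Complex.re h
  have h2 : (1 - Complex.I * (ω : ℂ)) ≠ 0 := fun h => by
    simpa using congrArg Complex.re h
  have e : ((2 / (1 + ω ^ 2) : ℝ) : ℂ)
      = 2 / ((1 + Complex.I * (ω : ℂ)) * (1 - Complex.I * (ω : ℂ))) := by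
    push_cast
    congr 1
    linear_combination ((ω : ℂ) ^ 2) * Complex.I_sq
  rw [e]
  field_simp
  ring

/-- Schur's test for a symmetric kernel on a finite set. -/
lemma schur_symm {ι : Type*} (s : Finset ι) (a : ι → ℝ) (K : ι → ι → ℝ) (A : ℝ)
    (hK : ∀ p q, 0 ≤ K p q) (hsymm : ∀ p q, K p q = K q p) (hA : ∀ p ∈ s, ∑ q ∈ s, K p q ≤ A) :
    ∑ p ∈ s, ∑ q ∈ s, a p * a q * K p q ≤ A * ∑ p ∈ s, a p ^ 2 := by
  have h1 : ∑ p ∈ s, ∑ q ∈ s, a p * a q * K p q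
      ≤ ∑ p ∈ s, ∑ q ∈ s, (a p ^ 2 / 2 * K p q + a q ^ 2 / 2 * K q p) := by
    refine Finset.sum_le_sum fun p _ => Finset.sum_le_sum fun q _ => ?_
    rw [hsymm q p]
    nlinarith [hK p q, mul_nonneg (hK p q) (sq_nonneg (a p - a q))]
  refine h1.trans ?_
  simp_rw [Finset.sum_add_distrib]
  rw [Finset.sum_comm (f := fun p q => a q ^ 2 / 2 * K q p), ← two_mul, Finset.mul_sum,
    Finset.mul_sum]
  refine Finset.sum_le_sum fun p hp => ?_
  rw [← Finset.mul_sum]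
  nlinarith [hA p hp, sq_nonneg (a p)]

/-- An `L²` bound for space-time trigonometric sums. -/
lemma lintegral_trig_sum_le {ι : Type*} (s : Finset ι) (b : ι → ℂ) (ω : ι → ℝ)
    (k : ι → Fin 3 → ℤ) (T A : ℝ)
    (hA : ∀ p ∈ s, ∑ q ∈ s, (if k p = k q then 1 / (1 + (ω p - ω q) ^ 2) else 0) ≤ A) :
    ∫⁻ z in Set.Icc 0 T ×ˢ cube, ‖∑ p ∈ s, b p * (Complex.exp (Complex.I * ((ω p * z.1 : ℝ) : ℂ)) *
      Complex.exp (Complex.I * ((dotZ (k p) z.2 : ℝ) : ℂ)))‖ₑ ^ 2 ≤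
    ENNReal.ofReal (Real.exp T * (2 * (2 * Real.pi) ^ 3 * A * ∑ p ∈ s, ‖b p‖ ^ 2)) := by
  set F : ℝ × (Fin 3 → ℝ) → ℂ := fun z => ∑ p ∈ s, b p *
    (Complex.exp (Complex.I * ((ω p * z.1 : ℝ) : ℂ)) *
      Complex.exp (Complex.I * ((dotZ (k p) z.2 : ℝ) : ℂ))) with hF
  set μ : Measure (ℝ × (Fin 3 → ℝ)) := (volume : Measure ℝ).prod (volume.restrict cube) with hμ
  set H : ι → ι → ℝ × (Fin 3 → ℝ) → ℂ := fun p q z => (b p * (starRingEnd ℂ) (b q)) *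
    ((((Real.exp (-|z.1|) : ℝ) : ℂ) * Complex.exp (Complex.I * (((ω p - ω q) * z.1 : ℝ) : ℂ))) *
      Complex.exp (Complex.I * ((dotZ (k p - k q) z.2 : ℝ) : ℂ))) with hH
  have hHint : ∀ p q, Integrable (H p q) μ := fun p q =>
    ((integrable_exp_abs (ω p - ω q)).mul_prod (integrable_cube_exp (k p - k q))).const_mul _
  have hHval : ∀ p q, ∫ z, H p q z ∂μ = (b p * (starRingEnd ℂ) (b q)) *
      (((2 / (1 + (ω p - ω q) ^ 2) : ℝ) : ℂ) *
        if k p = k q then (((2 * Real.pi) ^ 3 : ℝ) : ℂ) else 0) := by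
    intro p q
    simp only [hH]
    rw [integral_const_mul, hμ, integral_prod_mul (fun t : ℝ => ((Real.exp (-|t|) : ℝ) : ℂ) *
      Complex.exp (Complex.I * (((ω p - ω q) * t : ℝ) : ℂ)))
      (fun x => Complex.exp (Complex.I * ((dotZ (k p - k q) x : ℝ) : ℂ))),
      integral_exp_abs, integral_cube_exp]
    simp only [sub_eq_zero]
  have hGH : ∀ z, ((Real.exp (-|z.1|) * ‖F z‖ ^ 2 : ℝ) : ℂ) = ∑ p ∈ s, ∑ q ∈ s, H p q z := by
    intro z
    push_cast
    rw [← Complex.mul_conj']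
    simp only [hF]
    rw [map_sum, Finset.sum_mul_sum, Finset.mul_sum]
    refine Finset.sum_congr rfl fun p _ => ?_
    rw [Finset.mul_sum]
    refine Finset.sum_congr rfl fun q _ => ?_
    simp only [map_mul]
    have e1 : Complex.exp (Complex.I * (((ω p - ω q) * z.1 : ℝ) : ℂ))
        = Complex.exp (Complex.I * ((ω p * z.1 : ℝ) : ℂ)) *
          (starRingEnd ℂ) (Complex.exp (Complex.I * ((ω q * z.1 : ℝ) : ℂ))) := by
      rw [← Complex.exp_conj, ← Complex.exp_add]
      congr 1
      simp only [map_mul, Complex.conj_I, Complex.conj_ofReal]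
      push_cast; ring
    have e2 : Complex.exp (Complex.I * ((dotZ (k p - k q) z.2 : ℝ) : ℂ))
        = Complex.exp (Complex.I * ((dotZ (k p) z.2 : ℝ) : ℂ)) *
          (starRingEnd ℂ) (Complex.exp (Complex.I * ((dotZ (k q) z.2 : ℝ) : ℂ))) := by
      rw [← Complex.exp_conj, ← Complex.exp_add]
      congr 1
      have : dotZ (k p - k q) z.2 = dotZ (k p) z.2 - dotZ (k q) z.2 := by
        simp only [dotZ, ← Finset.sum_sub_distrib]
        refine Finset.sum_congr rfl fun i _ => ?_
        push_cast [Pi.sub_apply]; ring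
      simp only [map_mul, Complex.conj_I, Complex.conj_ofReal, this]
      push_cast; ring
    simp only [hH]
    rw [e1, e2]
    push_cast
    ring
  have hGint : Integrable (fun z => Real.exp (-|z.1|) * ‖F z‖ ^ 2) μ := by
    have h1 : Integrable (fun z => ((Real.exp (-|z.1|) * ‖F z‖ ^ 2 : ℝ) : ℂ)) μ := by
      simp_rw [hGH]
      exact integrable_finsetSum _ fun p _ => integrable_finsetSum _ fun q _ => hHint p q
    exact h1.re.congr (ae_of_all _ fun z => Complex.ofReal_re _)
  have hGle : ∫ z, Real.exp (-|z.1|) * ‖F z‖ ^ 2 ∂μ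
      ≤ 2 * (2 * Real.pi) ^ 3 * A * ∑ p ∈ s, ‖b p‖ ^ 2 := by
    have h1 : ((∫ z, Real.exp (-|z.1|) * ‖F z‖ ^ 2 ∂μ : ℝ) : ℂ)
        = ∑ p ∈ s, ∑ q ∈ s, ∫ z, H p q z ∂μ := by
      rw [← integral_complex_ofReal]
      simp_rw [hGH]
      rw [integral_finsetSum _ fun p _ => integrable_finsetSum _ fun q _ => hHint p q]
      exact Finset.sum_congr rfl fun p _ => integral_finsetSum _ fun q _ => hHint p q
    have h2 : ∫ z, Real.exp (-|z.1|) * ‖F z‖ ^ 2 ∂μ ≤ ‖∑ p ∈ s, ∑ q ∈ s, ∫ z, H p q z ∂μ‖ := by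
      rw [← h1, Complex.norm_real]; exact le_abs_self _
    refine h2.trans ((norm_sum_le_of_le _ fun p _ => norm_sum_le _ _).trans ?_)
    have h3 : ∀ p q, ‖∫ z, H p q z ∂μ‖ = 2 * (2 * Real.pi) ^ 3 *
        (‖b p‖ * ‖b q‖ * (if k p = k q then 1 / (1 + (ω p - ω q) ^ 2) else 0)) := by
      intro p q
      rw [hHval, norm_mul, norm_mul, norm_mul, RCLike.norm_conj, Complex.norm_real,
        Real.norm_of_nonneg (by positivity)]
      split_ifs
      · rw [Complex.norm_real, Real.norm_of_nonneg (by positivity)]; ring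
      · simp
    simp_rw [h3, ← Finset.mul_sum]
    rw [mul_assoc (2 * (2 * Real.pi) ^ 3)]
    gcongr
    refine schur_symm s (fun p => ‖b p‖) _ A (fun p q => ?_) (fun p q => ?_) hA
    · split_ifs <;> positivity
    · rw [show (ω p - ω q) ^ 2 = (ω q - ω p) ^ 2 by ring]
      simp only [eq_comm]
  have hmu : (volume : Measure (ℝ × (Fin 3 → ℝ))).restrict (Set.Icc 0 T ×ˢ cube)
      = μ.restrict (Set.Icc 0 T ×ˢ Set.univ) := by
    rw [hμ, ← Measure.prod_restrict, Measure.restrict_univ, Measure.prod_restrict]; rfl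
  rw [hmu]
  calc ∫⁻ z in Set.Icc 0 T ×ˢ Set.univ, ‖F z‖ₑ ^ 2 ∂μ
      ≤ ∫⁻ z in Set.Icc 0 T ×ˢ Set.univ,
          ENNReal.ofReal (Real.exp T * (Real.exp (-|z.1|) * ‖F z‖ ^ 2)) ∂μ := by
        refine setLIntegral_mono' (measurableSet_Icc.prod MeasurableSet.univ) fun z hz => ?_
        rw [← ofReal_norm, ← ENNReal.ofReal_pow (norm_nonneg _)]
        apply ENNReal.ofReal_le_ofReal
        rw [← mul_assoc, ← Real.exp_add, abs_of_nonneg hz.1.1]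
        have : 1 ≤ Real.exp (T + -z.1) := Real.one_le_exp (by linarith [hz.1.2])
        nlinarith [sq_nonneg ‖F z‖]
    _ ≤ ∫⁻ z, ENNReal.ofReal (Real.exp T * (Real.exp (-|z.1|) * ‖F z‖ ^ 2)) ∂μ :=
        setLIntegral_le_lintegral _ _
    _ = ENNReal.ofReal (∫ z, Real.exp T * (Real.exp (-|z.1|) * ‖F z‖ ^ 2) ∂μ) := by
        rw [ofReal_integral_eq_lintegral_ofReal (hGint.const_mul _)]
        exact ae_of_all _ fun z => by positivity
    _ ≤ _ := by
        apply ENNReal.ofReal_le_ofReal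
        rw [integral_const_mul]
        gcongr

lemma summable_three_div_one_add_sq : Summable fun m : ℤ => 3 / (1 + (m : ℝ) ^ 2) := by
  have h : Summable fun m : ℤ => 1 / (m : ℝ) ^ 2 := Real.summable_one_div_int_pow.2 (by norm_num)
  refine Summable.of_norm_bounded_eventually (h.mul_left 3) ?_
  filter_upwards [(Set.finite_singleton (0 : ℤ)).compl_mem_cofinite] with m hm
  have hm0 : (m : ℝ) ≠ 0 := Int.cast_ne_zero.2 hm
  have hm2 : 0 < (m : ℝ) ^ 2 := by positivity
  rw [Real.norm_of_nonneg (by positivity), mul_one_div]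
  gcongr
  linarith

lemma inv_one_add_sq_le_floor (x : ℝ) : 1 / (1 + x ^ 2) ≤ 3 / (1 + (⌊x⌋ : ℝ) ^ 2) := by
  rw [div_le_div_iff₀ (by positivity) (by positivity)]
  have h1 := Int.floor_le x
  have h2 := Int.lt_floor_add_one x
  have h3 : (x - ⌊x⌋) ^ 2 ≤ 1 := by nlinarith
  nlinarith [sq_nonneg (x + (x - ⌊x⌋))]

/-- A sum of `1 / (1 + (y - f q)²)` over a set on which each unit interval contains at most `A`
values of `f`. -/
lemma sum_inv_one_add_sq_le_s10 {ι : Type*} (E : Finset ι) (f : ι → ℝ) (y A : ℝ) (hA0 : 0 ≤ A)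
    (hA : ∀ τ : ℝ, ((E.filter fun q => τ ≤ f q ∧ f q < τ + 1).card : ℝ) ≤ A) :
    ∑ q ∈ E, 1 / (1 + (y - f q) ^ 2) ≤ A * ∑' m : ℤ, 3 / (1 + (m : ℝ) ^ 2) := by
  calc ∑ q ∈ E, 1 / (1 + (y - f q) ^ 2)
      ≤ ∑ q ∈ E, 3 / (1 + (⌊f q - y⌋ : ℝ) ^ 2) := by
        refine Finset.sum_le_sum fun q _ => ?_
        rw [show (y - f q) ^ 2 = (f q - y) ^ 2 by ring]
        exact inv_one_add_sq_le_floor _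
    _ = ∑ m ∈ E.image fun q => ⌊f q - y⌋,
          (E.filter fun q => ⌊f q - y⌋ = m).card • (3 / (1 + (m : ℝ) ^ 2)) :=
        Finset.sum_comp (fun m : ℤ => 3 / (1 + (m : ℝ) ^ 2)) fun q => ⌊f q - y⌋
    _ ≤ ∑ m ∈ E.image fun q => ⌊f q - y⌋, A * (3 / (1 + (m : ℝ) ^ 2)) := by
        refine Finset.sum_le_sum fun m _ => ?_
        rw [nsmul_eq_mul]
        gcongr
        refine le_trans ?_ (hA (y + m))
        norm_cast
        refine Finset.card_le_card fun q hq => ?_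
        obtain ⟨h1, h2⟩ := Finset.mem_filter.1 hq
        rw [Int.floor_eq_iff] at h2
        exact Finset.mem_filter.2 ⟨h1, by linarith [h2.1], by linarith [h2.2]⟩
    _ ≤ A * ∑' m : ℤ, 3 / (1 + (m : ℝ) ^ 2) := by
        rw [← Finset.mul_sum]
        gcongr
        exact summable_three_div_one_add_sq.sum_le_tsum _ fun m _ => by positivity

lemma mem_latticeBall {ξ₀ n : Fin 3 → ℤ} {M : ℝ} (h : n ∈ latticeBall ξ₀ M) :
    normZ (n - ξ₀) ≤ M := (Finset.mem_filter.1 h).2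

/-- The constant of the `L⁴` estimate for free solutions. -/
noncomputable def freeConst (T : ℝ) : ℝ :=
  Real.exp T * (2 * (2 * Real.pi) ^ 3 * (114000 * ∑' m : ℤ, 3 / (1 + (m : ℝ) ^ 2)))

lemma freeConst_pos (T : ℝ) : 0 < freeConst T := by
  have : 0 < ∑' m : ℤ, 3 / (1 + (m : ℝ) ^ 2) :=
    summable_three_div_one_add_sq.tsum_pos (fun m => by positivity) 0 (by norm_num)
  unfold freeConst
  positivity

/-- The `L⁴` estimate for free solutions localized to a ball. -/
lemma lintegral_free_le (T M N : ℝ) (hM : 1 ≤ M) (hMN : M ≤ N) (ξ₀ : Fin 3 → ℤ)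
    (hξ : normZ ξ₀ < 2 * N) (σ : ℝ) (hσ : σ = 1 ∨ σ = -1) (a : (Fin 3 → ℤ) → ℂ) :
    ∫⁻ z in Set.Icc 0 T ×ˢ cube, ‖freqLocFun (latticeBall ξ₀ M)
      (fun n t => a n * Complex.exp (Complex.I * ((σ * jbZ n * t : ℝ) : ℂ))) z.1 z.2‖ₑ ^ 4 ≤
    ENNReal.ofReal (freeConst T * N * M * (∑ n ∈ latticeBall ξ₀ M, ‖a n‖ ^ 2) ^ 2) := by
  have hN : 1 ≤ N := hM.trans hMN
  set S := latticeBall ξ₀ M with hS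
  set f : (Fin 3 → ℤ) × (Fin 3 → ℤ) → ℝ := fun q => jbZ q.1 + jbZ q.2 with hf
  have hσ2 : σ ^ 2 = 1 := by rcases hσ with rfl | rfl <;> norm_num
  have hmain := lintegral_trig_sum_le (S ×ˢ S) (fun q => a q.1 * a q.2) (fun q => σ * f q)
    (fun q => q.1 + q.2) T (114000 * N * M * ∑' m : ℤ, 3 / (1 + (m : ℝ) ^ 2)) (by
      intro p _
      rw [← Finset.sum_filter]
      have e : ∀ q, (σ * f p - σ * f q) ^ 2 = (f p - f q) ^ 2 := fun q => by
        rw [← mul_sub, mul_pow, hσ2, one_mul]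
      simp_rw [e]
      refine sum_inv_one_add_sq_le_s10 _ f (f p) (114000 * N * M) (by positivity) fun τ => ?_
      refine card_resonant_pairs _ (p.1 + p.2) ξ₀ M N τ hM hMN hξ fun q hq => ?_
      simp only [Finset.mem_filter, Finset.mem_product] at hq
      exact ⟨hq.1.2.symm, mem_latticeBall hq.1.1.1, mem_latticeBall hq.1.1.2, hq.2⟩)
  have hsum : ∑ q ∈ S ×ˢ S, ‖a q.1 * a q.2‖ ^ 2 = (∑ n ∈ S, ‖a n‖ ^ 2) ^ 2 := by
    rw [sq (∑ n ∈ S, ‖a n‖ ^ 2), Finset.sum_mul_sum, ← Finset.sum_product']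
    refine Finset.sum_congr rfl fun q _ => ?_
    rw [norm_mul, mul_pow]
  rw [hsum] at hmain
  refine le_trans (le_of_eq ?_) (hmain.trans (le_of_eq ?_))
  · refine lintegral_congr fun z => ?_
    rw [show 4 = 2 * 2 from rfl, pow_mul, ← enorm_pow]
    congr 2
    rw [sq, freqLocFun, Finset.sum_mul_sum, ← Finset.sum_product']
    refine Finset.sum_congr rfl fun q _ => ?_
    have e1 : Complex.exp (Complex.I * ((σ * f q * z.1 : ℝ) : ℂ))
        = Complex.exp (Complex.I * ((σ * jbZ q.1 * z.1 : ℝ) : ℂ)) *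
          Complex.exp (Complex.I * ((σ * jbZ q.2 * z.1 : ℝ) : ℂ)) := by
      rw [← Complex.exp_add]; congr 1; simp only [hf]; push_cast; ring
    have e2 : Complex.exp (Complex.I * ((dotZ (q.1 + q.2) z.2 : ℝ) : ℂ))
        = Complex.exp (Complex.I * ((dotZ q.1 z.2 : ℝ) : ℂ)) *
          Complex.exp (Complex.I * ((dotZ q.2 z.2 : ℝ) : ℂ)) := by
      have : dotZ (q.1 + q.2) z.2 = dotZ q.1 z.2 + dotZ q.2 z.2 := by
        simp only [dotZ, ← Finset.sum_add_distrib]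
        refine Finset.sum_congr rfl fun i _ => ?_
        push_cast [Pi.add_apply]; ring
      rw [← Complex.exp_add, this]; congr 1; push_cast; ring
    rw [e1, e2]
    ring
  · unfold freeConst
    congr 1
    ring

/-- The functional sending `φ` to the value at `z = (t, x)` of the free solution with data `φ`. -/
noncomputable def freeEval (S : Finset (Fin 3 → ℤ)) (σ : ℝ) (z : ℝ × (Fin 3 → ℝ)) :
    EuclideanSpace ℂ ↥S →L[ℂ] ℂ :=
  ∑ n : ↥S, (Complex.exp (Complex.I * ((σ * jbZ n * z.1 : ℝ) : ℂ)) *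
    Complex.exp (Complex.I * ((dotZ n z.2 : ℝ) : ℂ))) • EuclideanSpace.proj n

lemma freeEval_apply (S : Finset (Fin 3 → ℤ)) (σ : ℝ) (z : ℝ × (Fin 3 → ℝ))
    (φ : EuclideanSpace ℂ ↥S) : freeEval S σ z φ =
      ∑ n : ↥S, (Complex.exp (Complex.I * ((σ * jbZ n * z.1 : ℝ) : ℂ)) *
        Complex.exp (Complex.I * ((dotZ n z.2 : ℝ) : ℂ))) * φ n := by
  simp [freeEval]

lemma freqLocFun_eq_freeEval (S : Finset (Fin 3 → ℤ)) (σ : ℝ) (c : (Fin 3 → ℤ) → ℝ → ℂ)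
    (z : ℝ × (Fin 3 → ℝ)) : freqLocFun S c z.1 z.2 = freeEval S σ z (modCurve S σ c z.1) := by
  rw [freeEval_apply, freqLocFun, ← Finset.sum_coe_sort]
  refine Finset.sum_congr rfl fun n _ => ?_
  have e : Complex.exp (Complex.I * ((σ * jbZ n * z.1 : ℝ) : ℂ)) *
      Complex.exp (-(Complex.I * ((σ * jbZ n * z.1 : ℝ) : ℂ))) = 1 := by
    rw [← Complex.exp_add, add_neg_cancel, Complex.exp_zero]
  have e' : modCurve S σ c z.1 n
      = Complex.exp (-(Complex.I * ((σ * jbZ n * z.1 : ℝ) : ℂ))) * c n z.1 := rfl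
  rw [e']
  linear_combination (-(c n z.1) * Complex.exp (Complex.I * ((dotZ n z.2 : ℝ) : ℂ))) * e

lemma continuous_freeEval_apply (S : Finset (Fin 3 → ℤ)) (σ : ℝ) (φ : EuclideanSpace ℂ ↥S) :
    Continuous fun z => freeEval S σ z φ := by
  simp_rw [freeEval_apply]
  unfold dotZ
  fun_prop

lemma freeEval_eq_freqLocFun (S : Finset (Fin 3 → ℤ)) (σ : ℝ) (z : ℝ × (Fin 3 → ℝ))
    (a : (Fin 3 → ℤ) → ℂ) (φ : EuclideanSpace ℂ ↥S) (ha : ∀ n : ↥S, a n = φ n) :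
    freqLocFun S (fun n t => a n * Complex.exp (Complex.I * ((σ * jbZ n * t : ℝ) : ℂ))) z.1 z.2
      = freeEval S σ z φ := by
  rw [freeEval_apply, freqLocFun, ← Finset.sum_coe_sort]
  refine Finset.sum_congr rfl fun n _ => ?_
  rw [ha]
  ring

lemma lintegral_freeEval_le (T M N : ℝ) (hM : 1 ≤ M) (hMN : M ≤ N) (ξ₀ : Fin 3 → ℤ)
    (hξ : normZ ξ₀ < 2 * N) (σ : ℝ) (hσ : σ = 1 ∨ σ = -1)
    (φ : EuclideanSpace ℂ ↥(latticeBall ξ₀ M)) :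
    ∫⁻ z in Set.Icc 0 T ×ˢ cube, ‖freeEval (latticeBall ξ₀ M) σ z φ‖ₑ ^ 4 ≤
    ENNReal.ofReal (freeConst T * N * M * ‖φ‖ ^ 4) := by
  obtain ⟨a, ha⟩ : ∃ a : (Fin 3 → ℤ) → ℂ, ∀ n : ↥(latticeBall ξ₀ M), a n = φ n :=
    ⟨fun n => if h : n ∈ latticeBall ξ₀ M then φ ⟨n, h⟩ else 0, fun n => dif_pos n.2⟩
  have h := lintegral_free_le T M N hM hMN ξ₀ hξ σ hσ a
  have e : (∑ n ∈ latticeBall ξ₀ M, ‖a n‖ ^ 2) ^ 2 = ‖φ‖ ^ 4 := by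
    rw [show ‖φ‖ ^ 4 = (‖φ‖ ^ 2) ^ 2 by ring, EuclideanSpace.norm_sq_eq, ← Finset.sum_coe_sort]
    simp_rw [ha]
  rw [e] at h
  simpa only [freeEval_eq_freqLocFun _ σ _ a φ ha] using h

/-- A step function takes at each time one of its values, or zero. -/
lemma step_eq_zero_or {B : Type*} [AddCommMonoid B] {K : ℕ} (t : Fin (K + 1) → EReal)
    (ht : StrictMono t) (φ : Fin K → B) (s : ℝ) :
    (∑ k : Fin K, if t k.castSucc ≤ (s : EReal) ∧ (s : EReal) < t k.succ then φ k else 0) = 0 ∨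
    ∃ k, (∑ k : Fin K, if t k.castSucc ≤ (s : EReal) ∧ (s : EReal) < t k.succ then φ k else 0)
      = φ k := by
  by_cases h : ∃ k : Fin K, t k.castSucc ≤ (s : EReal) ∧ (s : EReal) < t k.succ
  · obtain ⟨k, hk⟩ := h
    refine Or.inr ⟨k, ?_⟩
    rw [Finset.sum_eq_single k, if_pos hk]
    · intro j _ hj
      refine if_neg fun hj' => ?_
      rcases lt_or_gt_of_ne hj with hlt | hlt
      · have h1 : t j.succ ≤ t k.castSucc := ht.monotone (by
          rw [Fin.le_def]; simp only [Fin.val_succ, Fin.val_castSucc]; exact hlt)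
        exact absurd (hj'.2.trans_le (h1.trans hk.1)) (lt_irrefl _)
      · have h1 : t k.succ ≤ t j.castSucc := ht.monotone (by
          rw [Fin.le_def]; simp only [Fin.val_succ, Fin.val_castSucc]; exact hlt)
        exact absurd (hk.2.trans_le (h1.trans hj'.1)) (lt_irrefl _)
    · simp
  · push Not at h
    exact Or.inl (Finset.sum_eq_zero fun k _ => if_neg fun hk => absurd hk.2 (not_lt.2 (h k hk.1)))

lemma aestronglyMeasurable_freeEval_atom (S : Finset (Fin 3 → ℤ)) (σ p : ℝ)
    (a : ℝ → EuclideanSpace ℂ ↥S) (ha : IsUpAtom p a) (μ : Measure (ℝ × (Fin 3 → ℝ))) :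
    AEStronglyMeasurable (fun z => freeEval S σ z (a z.1)) μ := by
  obtain ⟨K, t, φ, -, -, -, hs⟩ := ha
  simp_rw [hs, map_sum]
  refine Measurable.aestronglyMeasurable (Finset.measurable_sum _ fun k _ => ?_)
  simp_rw [apply_ite (freeEval S σ _), map_zero]
  refine Measurable.ite ?_ (continuous_freeEval_apply S σ (φ k)).measurable measurable_const
  have hm : Measurable fun z : ℝ × (Fin 3 → ℝ) => (z.1 : EReal) :=
    measurable_coe_real_ereal.comp measurable_fst
  exact (measurableSet_le measurable_const hm).inter (measurableSet_lt hm measurable_const)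

lemma eLpNorm_freeEval_atom_le (T M N : ℝ) (hM : 1 ≤ M) (hMN : M ≤ N) (ξ₀ : Fin 3 → ℤ)
    (hξ : normZ ξ₀ < 2 * N) (σ : ℝ) (hσ : σ = 1 ∨ σ = -1)
    (a : ℝ → EuclideanSpace ℂ ↥(latticeBall ξ₀ M)) (ha : IsUpAtom 4 a) :
    eLpNorm (fun z => freeEval (latticeBall ξ₀ M) σ z (a z.1)) 4
      (volume.restrict (Set.Icc 0 T ×ˢ cube)) ≤
    ENNReal.ofReal (freeConst T ^ ((1 : ℝ) / 4) * N ^ ((1 : ℝ) / 4) * M ^ ((1 : ℝ) / 4)) := by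
  have hc := freeConst_pos T
  have hN : 1 ≤ N := hM.trans hMN
  obtain ⟨K, t, φ, ht, -, hφ, hs⟩ := ha
  have hpt : ∀ z : ℝ × (Fin 3 → ℝ), ‖freeEval (latticeBall ξ₀ M) σ z (a z.1)‖ₑ ^ 4 ≤
      ∑ k, ‖freeEval (latticeBall ξ₀ M) σ z (φ k)‖ₑ ^ 4 := by
    intro z
    rw [hs]
    rcases step_eq_zero_or t ht φ z.1 with h | ⟨k, h⟩
    · rw [h]; simp
    · rw [h]
      exact Finset.single_le_sum
        (f := fun k => ‖freeEval (latticeBall ξ₀ M) σ z (φ k)‖ₑ ^ 4) (fun _ _ => zero_le)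
        (Finset.mem_univ k)
  have hint : ∫⁻ z in Set.Icc 0 T ×ˢ cube, ‖freeEval (latticeBall ξ₀ M) σ z (a z.1)‖ₑ ^ 4
      ≤ ENNReal.ofReal (freeConst T * N * M) := by
    calc _ ≤ ∫⁻ z in Set.Icc 0 T ×ˢ cube, ∑ k, ‖freeEval (latticeBall ξ₀ M) σ z (φ k)‖ₑ ^ 4 :=
          lintegral_mono hpt
      _ = ∑ k, ∫⁻ z in Set.Icc 0 T ×ˢ cube, ‖freeEval (latticeBall ξ₀ M) σ z (φ k)‖ₑ ^ 4 :=
          lintegral_finsetSum _ fun k _ =>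
            ((continuous_freeEval_apply _ σ (φ k)).measurable.enorm.pow_const 4)
      _ ≤ ∑ k, ENNReal.ofReal (freeConst T * N * M * ‖φ k‖ ^ 4) :=
          Finset.sum_le_sum fun k _ => lintegral_freeEval_le T M N hM hMN ξ₀ hξ σ hσ (φ k)
      _ = ENNReal.ofReal (freeConst T * N * M) := by
          rw [← ENNReal.ofReal_sum_of_nonneg fun k _ => by positivity, ← Finset.mul_sum]
          have : ∑ k, ‖φ k‖ ^ 4 = 1 := by
            rw [← hφ]
            exact Finset.sum_congr rfl fun k _ => by norm_cast
          rw [this, mul_one]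
  rw [eLpNorm_eq_lintegral_rpow_enorm_toReal (by norm_num) (by norm_num)]
  have h4 : (4 : ℝ≥0∞).toReal = 4 := by norm_num
  rw [h4]
  simp_rw [ENNReal.rpow_ofNat]
  rw [← Real.mul_rpow hc.le (by positivity), ← Real.mul_rpow (by positivity) (by positivity),
    ← ENNReal.ofReal_rpow_of_pos (by positivity)]
  gcongr

/-- **Refined L⁴ estimate for ball-localized functions**
(Proposition 5.5 in dimension three).  For every `T > 0` there exists `C_T > 0` such that
for all `M, N ≥ 1` with `M ≤ N`, every `ξ₀ ∈ ℤ³` with `N ≤ |ξ₀| < 2N`, every sign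
`σ ∈ {+1, -1}`, and every space-time function
`u(t,x) = ∑_{|n - ξ₀| ≤ M} c_n(t) e^{i n·x}` with measurable coefficients,
`‖u‖_{L⁴([0,T]×T³)} ≤ C_T N^{1/4} M^{1/4} ‖u‖_{U⁴_σ}`. -/
theorem refined_L4_ball_localized (T : ℝ) (hT : 0 < T) :
    ∃ C > (0:ℝ), ∀ M N : ℝ, 1 ≤ M → 1 ≤ N → M ≤ N →
      ∀ ξ₀ : Fin 3 → ℤ, N ≤ normZ ξ₀ → normZ ξ₀ < 2 * N →
      ∀ σ : ℝ, (σ = 1 ∨ σ = -1) →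
      ∀ c : (Fin 3 → ℤ) → ℝ → ℂ, (∀ n, Measurable (c n)) →
      eLpNorm (fun q : ℝ × (Fin 3 → ℝ) => freqLocFun (latticeBall ξ₀ M) c q.1 q.2)
          4 (volume.restrict (Set.Icc 0 T ×ˢ cube)) ≤
        ENNReal.ofReal (C * N ^ ((1:ℝ)/4) * M ^ ((1:ℝ)/4)) *
          UpNorm 4 (modCurve (latticeBall ξ₀ M) σ c) := by
  refine ⟨freeConst T ^ ((1 : ℝ) / 4), Real.rpow_pos_of_pos (freeConst_pos T) _, ?_⟩
  intro M N hM hN hMN ξ₀ _ hξ σ hσ c _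
  set Q := ENNReal.ofReal (freeConst T ^ ((1 : ℝ) / 4) * N ^ ((1 : ℝ) / 4) * M ^ ((1 : ℝ) / 4))
  have hQ0 : Q ≠ 0 := by
    have := freeConst_pos T
    exact (ENNReal.ofReal_pos.2 (by positivity)).ne'
  simp_rw [freqLocFun_eq_freeEval _ σ]
  rw [← ENNReal.div_le_iff' hQ0 ENNReal.ofReal_ne_top, UpNorm]
  refine le_sInf ?_
  rintro _ ⟨lam, a, ha, hlam, hsum, rfl⟩
  rw [ENNReal.div_le_iff' hQ0 ENNReal.ofReal_ne_top]
  have hmeas : ∀ j, AEStronglyMeasurable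
      (fun z : ℝ × (Fin 3 → ℝ) => lam j • freeEval (latticeBall ξ₀ M) σ z (a j z.1))
      (volume.restrict (Set.Icc 0 T ×ˢ cube)) := fun j =>
    (aestronglyMeasurable_freeEval_atom _ σ 4 (a j) (ha j) _).const_smul (lam j)
  refine Lp.eLpNorm_le_of_ae_tendsto (u := atTop) (f := fun (n : ℕ) =>
    ∑ j ∈ Finset.range n, fun z => lam j • freeEval (latticeBall ξ₀ M) σ z (a j z.1))
    (Eventually.of_forall fun n => ?_)
    (fun n => Finset.aestronglyMeasurable_sum _ fun j _ => hmeas j) (ae_of_all _ fun z => ?_)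
  · calc _ ≤ ∑ j ∈ Finset.range n, eLpNorm
            (fun z => lam j • freeEval (latticeBall ξ₀ M) σ z (a j z.1)) 4
            (volume.restrict (Set.Icc 0 T ×ˢ cube)) :=
          eLpNorm_sum_le (fun j _ => hmeas j) (by norm_num)
      _ ≤ ∑ j ∈ Finset.range n, ENNReal.ofReal ‖lam j‖ * Q := by
          refine Finset.sum_le_sum fun j _ => ?_
          refine (eLpNorm_const_smul_le (c := lam j)
            (f := fun z => freeEval (latticeBall ξ₀ M) σ z (a j z.1))).trans ?_
          rw [ofReal_norm]
          gcongr
          exact eLpNorm_freeEval_atom_le T M N hM hMN ξ₀ hξ σ hσ (a j) (ha j)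
      _ = Q * ENNReal.ofReal (∑ j ∈ Finset.range n, ‖lam j‖) := by
          rw [← Finset.sum_mul, ENNReal.ofReal_sum_of_nonneg fun _ _ => norm_nonneg _, mul_comm]
      _ ≤ _ := by
          gcongr
          exact hlam.sum_le_tsum _ fun _ _ => norm_nonneg _
  · have := ((hsum z.1).mapL (freeEval (latticeBall ξ₀ M) σ z)).tendsto_sum_nat
    simpa [Finset.sum_apply] using this
end
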